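/- arXiv:1805.09685 — 2 statements merged into one kernel-verified Lean document; each statement's English description precedes it below -/
import Mathlib

section
/- Let ω ∈ W_0 satisfy γ(ω) > 1, and let γ satisfy 0 < γ < min(2, γ(ω) − 1). Then the Borel map on the Beurling class is surjective: for every complex sequence λ = (λ_p)_{p∈ℕ} such that |λ|_{ω,l} < ∞ for every l > 0, there exists f holomorphic on S_γ with ‖f‖_{ω,l} < ∞ for every l > 0 and such that for every p ∈ ℕ, f^{(p)}(z) → λ_p as z → 0 within S_γ. -/
open Filter MeasureTheory Set Asymptotics

noncomputable section

/-- A *weight function*: continuous and nondecreasing on `[0,∞)`, vanishing at `0`,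
and tending to `+∞` at `+∞`. -/
structure IsWeightFunction (ω : ℝ → ℝ) : Prop where
  continuousOn : ContinuousOn ω (Set.Ici 0)
  monotoneOn : MonotoneOn ω (Set.Ici 0)
  map_zero : ω 0 = 0
  tendsto_atTop : Filter.Tendsto ω Filter.atTop Filter.atTop

/-- Condition `(P_{ω,γ})`: there is `K > 1` with `limsup_{t→∞} ω(K^γ t)/ω(t) < K`,
expressed through an eventual bound by some `c < K`. -/
def Pcond (ω : ℝ → ℝ) (γ : ℝ) : Prop :=
  ∃ K : ℝ, 1 < K ∧ ∃ c : ℝ, c < K ∧ ∀ᶠ t : ℝ in Filter.atTop, ω (K ^ γ * t) / ω t ≤ c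

/-- The growth index `γ(ω) ∈ [0,+∞]`, with `sup ∅ = 0`. -/
noncomputable def gammaIndex (ω : ℝ → ℝ) : ENNReal :=
  ⨆ γ ∈ {γ : ℝ | 0 < γ ∧ Pcond ω γ}, ENNReal.ofReal γ

/-- Condition `(ω₁)`. -/
def Omega1 (ω : ℝ → ℝ) : Prop :=
  ∃ L : ℝ, 1 ≤ L ∧ ∀ t : ℝ, 0 ≤ t → ω (2 * t) ≤ L * (ω t + 1)

/-- Condition `(ω₃)`: `log t = o(ω t)` as `t → ∞`. -/
def Omega3 (ω : ℝ → ℝ) : Prop :=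
  (fun t : ℝ => Real.log t) =o[Filter.atTop] ω

/-- Condition `(ω₄)`: `t ↦ ω (exp t)` is convex on `ℝ`. -/
def Omega4 (ω : ℝ → ℝ) : Prop :=
  ConvexOn ℝ Set.univ (fun t : ℝ => ω (Real.exp t))

/-- Condition `(ω₅)`: `ω t = o(t)` as `t → ∞`. -/
def Omega5 (ω : ℝ → ℝ) : Prop :=
  ω =o[Filter.atTop] (fun t : ℝ => t)

/-- Condition `(ω_snq)`. -/
def OmegaSnq (ω : ℝ → ℝ) : Prop :=
  ∃ C : ℝ, 0 < C ∧ ∀ y : ℝ, 0 < y →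
    (∫⁻ t in Set.Ioi (1:ℝ), ENNReal.ofReal (ω (y * t) / t ^ 2)) ≤
      ENNReal.ofReal (C * (ω y + 1))

/-- `ω ∈ W₀`: normalized weight function with `(ω₃)` and `(ω₄)`. -/
def InW0 (ω : ℝ → ℝ) : Prop :=
  IsWeightFunction ω ∧ (∀ t ∈ Set.Icc (0:ℝ) 1, ω t = 0) ∧ Omega3 ω ∧ Omega4 ω

/-- The Legendre–Fenchel–Young conjugate `φ*_ω(x) = sup {x y − ω(e^y) : y ≥ 0}`. -/
noncomputable def phiStar (ω : ℝ → ℝ) (x : ℝ) : ℝ :=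
  sSup ((fun y : ℝ => x * y - ω (Real.exp y)) '' Set.Ici 0)

/-- The associated weight matrix `W^l_j = exp((1/l) φ*_ω(l j))`. -/
noncomputable def Wseq (ω : ℝ → ℝ) (l : ℝ) (j : ℕ) : ℝ :=
  Real.exp ((1 / l) * phiStar ω (l * (j : ℝ)))

/-- `w^l_j = W^l_j / j!`. -/
noncomputable def wseq (ω : ℝ → ℝ) (l : ℝ) (j : ℕ) : ℝ :=
  Wseq ω l j / (Nat.factorial j : ℝ)

/-- `h_M(t) = inf_{k ∈ ℕ} M_k t^k`. -/
noncomputable def hFun (M : ℕ → ℝ) (t : ℝ) : ℝ :=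
  ⨅ k : ℕ, M k * t ^ k

/-- The associated function `ω_M(t) = sup_p log (t^p / M_p)` for `t > 0`, `ω_M(0) = 0`. -/
noncomputable def assocWeight (M : ℕ → ℝ) (t : ℝ) : ℝ :=
  if t ≤ 0 then 0 else ⨆ p : ℕ, Real.log (t ^ p / M p)

/-- The upper Legendre conjugate `ω⋆(s) = sup_{t ≥ 0} (ω(t) − s t)`. -/
noncomputable def upperConj (ω : ℝ → ℝ) (s : ℝ) : ℝ :=
  sSup ((fun t : ℝ => ω t - s * t) '' Set.Ici 0)

/-- `(ω⋆)^ι(t) = ω⋆(1/t)` for `t > 0`, with value `0` at `t = 0`. -/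
noncomputable def upperConjIota (ω : ℝ → ℝ) (t : ℝ) : ℝ :=
  if t = 0 then 0 else upperConj ω (1 / t)

/-- The lower Legendre conjugate `(ω^ι)_⋆(t) = inf_{s > 0} (ω(1/s) + t s)`. -/
noncomputable def lowerConjIota (ω : ℝ → ℝ) (t : ℝ) : ℝ :=
  sInf ((fun s : ℝ => ω (1 / s) + t * s) '' Set.Ioi 0)

/-- The unbounded sector `S_γ ⊆ ℂ` of opening `γ π` bisected by direction `0`
(for `0 < γ < 2` it lies in `ℂ`). -/
def sector (γ : ℝ) : Set ℂ :=
  {z : ℂ | z ≠ 0 ∧ |Complex.arg z| < γ * Real.pi / 2}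

/-- `M ∈ LC`: positive, normalized, log-convex, `(M_p)^{1/p} → ∞`. -/
def LCseq (M : ℕ → ℝ) : Prop :=
  (∀ p, 0 < M p) ∧ M 0 = 1 ∧ M 0 ≤ M 1 ∧
  (∀ j : ℕ, 1 ≤ j → M j ^ 2 ≤ M (j - 1) * M (j + 1)) ∧
  Filter.Tendsto (fun p : ℕ => M p ^ ((1 : ℝ) / (p : ℝ))) Filter.atTop Filter.atTop

/-- The partial derivative `∂_i` of a function on `ℝ^d`. -/
noncomputable def partialDeriv {d : ℕ} (i : Fin d)
    (f : EuclideanSpace ℝ (Fin d) → ℂ) : EuclideanSpace ℝ (Fin d) → ℂ :=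
  fun x => fderiv ℝ f x (EuclideanSpace.single i 1)

/-- The iterated partial derivative `∂^j` for a multiindex `j ∈ ℕ^d`. -/
noncomputable def multiDeriv {d : ℕ} (j : Fin d → ℕ)
    (f : EuclideanSpace ℝ (Fin d) → ℂ) : EuclideanSpace ℝ (Fin d) → ℂ :=
  (List.finRange d).foldr (fun i g => (partialDeriv i)^[j i] g) f

end

theorem sector_subset_slitPlane {γ : ℝ} (hγ : γ < 2) : sector γ ⊆ Complex.slitPlane := by
  rintro z ⟨hz, harg⟩
  rw [Complex.mem_slitPlane_iff_arg]
  refine ⟨fun h => ?_, hz⟩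
  rw [h, abs_of_pos Real.pi_pos] at harg
  nlinarith [Real.pi_pos]

theorem isOpen_sector {γ : ℝ} (hγ : γ < 2) : IsOpen (sector γ) := by
  rw [isOpen_iff_mem_nhds]
  intro z hz
  have hc := Complex.continuousAt_arg (sector_subset_slitPlane hγ hz)
  filter_upwards [isOpen_ne.mem_nhds hz.1, hc.abs.eventually_lt continuousAt_const hz.2]
    with w hw hw' using ⟨hw, hw'⟩

theorem sector_mono {γ γ' : ℝ} (h : γ ≤ γ') : sector γ ⊆ sector γ' := fun z hz =>
  ⟨hz.1, hz.2.trans_le (by nlinarith [Real.pi_pos])⟩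

theorem sector_eq_image_exp {γ : ℝ} (hγ : γ < 2) :
    sector γ = Complex.exp '' {z | |z.im| < γ * Real.pi / 2} := by
  ext z
  constructor
  · rintro ⟨hz, harg⟩
    exact ⟨Complex.log z, by simpa [Complex.log_im] using harg, Complex.exp_log hz⟩
  · rintro ⟨w, hw, rfl⟩
    have hw' : |w.im| < γ * Real.pi / 2 := hw
    have hpi : |w.im| < Real.pi := by nlinarith [Real.pi_pos]
    refine ⟨Complex.exp_ne_zero w, ?_⟩
    rw [← Complex.log_im, Complex.log_exp (abs_lt.1 hpi).1 (abs_lt.1 hpi).2.le]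
    exact hw'

theorem isPreconnected_sector {γ : ℝ} (hγ : γ < 2) : IsPreconnected (sector γ) := by
  rw [sector_eq_image_exp hγ]
  refine IsPreconnected.image (Convex.isPreconnected ?_) _ Complex.continuous_exp.continuousOn
  have : {z : ℂ | |z.im| < γ * Real.pi / 2}
      = Complex.imLm ⁻¹' (Metric.ball 0 (γ * Real.pi / 2)) := by
    ext z; simp
  rw [this]
  exact (convex_ball _ _).linear_preimage Complex.imLm

theorem inv_mem_sector {γ : ℝ} {z : ℂ} (hz : z ∈ sector γ) : z⁻¹ ∈ sector γ :=
  ⟨inv_ne_zero hz.1, by rw [Complex.abs_arg_inv]; exact hz.2⟩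

theorem ofReal_mul_mem_sector {γ : ℝ} {z : ℂ} (hz : z ∈ sector γ) {u : ℝ} (hu : 0 < u) :
    (u : ℂ) * z ∈ sector γ :=
  ⟨mul_ne_zero (by exact_mod_cast hu.ne') hz.1, by rw [Complex.arg_real_mul z hu]; exact hz.2⟩

theorem ofReal_mem_sector {γ : ℝ} (hγ : 0 < γ) {u : ℝ} (hu : 0 < u) : (u : ℂ) ∈ sector γ := by
  refine ⟨by exact_mod_cast hu.ne', ?_⟩
  rw [Complex.arg_ofReal_of_nonneg hu.le, abs_zero]
  positivity

/-- A smaller sector has discs of radius proportional to the modulus inside a larger one. -/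
theorem exists_closedBall_subset_sector {γ γ' : ℝ} (h : γ < γ') (hγ' : γ' < 2) :
    ∃ ε : ℝ, 0 < ε ∧ ε < 1 ∧ ∀ z ∈ sector γ, Metric.closedBall z (ε * ‖z‖) ⊆ sector γ' := by
  have hδ : 0 < (γ' - γ) * Real.pi / 2 := by
    have := Real.pi_pos
    have := sub_pos.2 h
    positivity
  have hc : ContinuousAt Complex.arg 1 := Complex.continuousAt_arg (by simp)
  have hev : ∀ᶠ w in nhds (1 : ℂ), |Complex.arg w| < (γ' - γ) * Real.pi / 2 := by
    refine hc.abs.eventually_lt continuousAt_const ?_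
    simpa using hδ
  obtain ⟨r, hr, hball⟩ := Metric.eventually_nhds_iff.1 hev
  refine ⟨min (r / 2) (1 / 2), by positivity, (min_le_right _ _).trans_lt (by norm_num), ?_⟩
  intro z hz y hy
  have hz0 : 0 < ‖z‖ := norm_pos_iff.2 hz.1
  have hdist : dist (y / z) 1 ≤ min (r / 2) (1 / 2) := by
    rw [Metric.mem_closedBall, dist_eq_norm] at hy
    rw [dist_eq_norm, div_sub_one hz.1, norm_div, div_le_iff₀ hz0]
    exact hy
  have hne : y / z ≠ 0 := by
    intro h0
    rw [h0] at hdist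
    have := hdist.trans (min_le_right _ _)
    norm_num at this
  have harg : |Complex.arg (y / z)| < (γ' - γ) * Real.pi / 2 :=
    hball (hdist.trans_lt ((min_le_left _ _).trans_lt (by linarith)))
  have hsum : |Complex.arg (y / z) + Complex.arg z| < γ' * Real.pi / 2 := by
    refine (abs_add_le _ _).trans_lt ?_
    have := hz.2
    nlinarith
  have hpi : |Complex.arg (y / z) + Complex.arg z| < Real.pi := by nlinarith [Real.pi_pos]
  have hy' : y / z * z = y := div_mul_cancel₀ _ hz.1
  refine ⟨by rw [← hy']; exact mul_ne_zero hne hz.1, ?_⟩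
  rw [← hy', Complex.arg_mul hne hz.1 ⟨(abs_lt.1 hpi).1, (abs_lt.1 hpi).2.le⟩]
  exact hsum

/-- Estimates of Taylor remainders at `0`, uniform in a sector, yield derivative estimates and the
limits of the derivatives at `0` in smaller sectors. -/
theorem norm_iteratedDeriv_sub_le_of_remainder {U : Set ℂ} {f : ℂ → ℂ}
    (hU : IsOpen U) (hf : DifferentiableOn ℂ f U) (a : ℕ → ℂ) {ε : ℝ} (hε : 0 < ε)
    {z : ℂ} (hz0 : z ≠ 0) (hz : Metric.closedBall z (ε * ‖z‖) ⊆ U) (p n : ℕ) {B : ℝ} (hB : 0 ≤ B)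
    (hrem : ∀ y ∈ U, ‖f y - ∑ k ∈ Finset.range n, a k * y ^ k‖ ≤ B * ‖y‖ ^ n) :
    ‖iteratedDeriv p f z - ∑ k ∈ Finset.range n, a k * ((k.descFactorial p : ℂ) * z ^ (k - p))‖
      ≤ p.factorial * (B * ((1 + ε) * ‖z‖) ^ n) / (ε * ‖z‖) ^ p := by
  have hzn : 0 < ‖z‖ := norm_pos_iff.2 hz0
  have hzU : z ∈ U := hz (Metric.mem_closedBall_self (by positivity))
  have hfa : ContDiffAt ℂ p f z := ((hf.analyticOnNhd hU) z hzU).contDiffAt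
  have hpa : ContDiff ℂ p (fun y : ℂ => ∑ k ∈ Finset.range n, a k * y ^ k) := by fun_prop
  have hsub : iteratedDeriv p (fun y => f y - ∑ k ∈ Finset.range n, a k * y ^ k) z
      = iteratedDeriv p f z
        - ∑ k ∈ Finset.range n, a k * ((k.descFactorial p : ℂ) * z ^ (k - p)) := by
    rw [iteratedDeriv_fun_sub hfa hpa.contDiffAt, iteratedDeriv_fun_sum]
    · simp only [iteratedDeriv_const_mul_field, iteratedDeriv_pow]
    · intro k _
      fun_prop
  rw [← hsub]
  refine Complex.norm_iteratedDeriv_le_of_forall_mem_sphere_norm_le p (by positivity) ?_ ?_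
  · refine DifferentiableOn.diffContOnCl ?_
    exact (hf.sub (by fun_prop)).mono (Metric.closure_ball_subset_closedBall.trans hz)
  · intro y hy
    have hyU := hz (Metric.sphere_subset_closedBall hy)
    refine (hrem y hyU).trans ?_
    have : ‖y‖ ≤ (1 + ε) * ‖z‖ := by
      have h1 : ‖y - z‖ = ε * ‖z‖ := by rw [← dist_eq_norm]; exact hy
      have := norm_le_norm_add_norm_sub' y z
      rw [h1] at this
      linarith
    gcongr

theorem norm_kernel_mul_le {e : ℂ → ℂ} {S : Set ℂ} {p : ℕ} {C C' : ℝ}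
    (hC : ∀ z ∈ S, ‖z‖ ^ p * (1 + ‖z‖ ^ 2) * ‖e z‖ ≤ C)
    {ψ : ℝ → ℂ} (hψ : ∀ u : ℝ, 0 < u → ‖ψ u‖ ≤ C' * u ^ p) {m : ℝ} (hm : 0 < m) {w : ℂ}
    (hmw : m ≤ ‖w‖) {u : ℝ} (hu : 0 < u) (hw : (u : ℂ) * w ∈ S) :
    ‖e (u * w) * ψ u‖ ≤ C * C' / m ^ p * (1 + (m * u) ^ 2)⁻¹ := by
  have h1 := hC _ hw
  have hn : ‖(u : ℂ) * w‖ = u * ‖w‖ := by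
    rw [norm_mul, Complex.norm_real, Real.norm_of_nonneg hu.le]
  rw [hn] at h1
  have h2 : (m * u) ^ p * (1 + (m * u) ^ 2) * ‖e (u * w)‖ ≤ C := by
    refine le_trans ?_ h1
    have : m * u ≤ u * ‖w‖ := by nlinarith
    gcongr
  have h3 := hψ u hu
  have hC0 : 0 ≤ C := le_trans (by positivity) h2
  rw [norm_mul, div_mul_eq_mul_div, le_div_iff₀ (by positivity), ← div_eq_mul_inv,
    le_div_iff₀ (by positivity)]
  have hup : 0 < u ^ p := by positivity
  have hC'0 : 0 ≤ C' := by
    by_contra hneg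
    have := (norm_nonneg _).trans h3
    nlinarith
  calc ‖e (u * w)‖ * ‖ψ u‖ * m ^ p * (1 + (m * u) ^ 2)
      ≤ ‖e (u * w)‖ * (C' * u ^ p) * m ^ p * (1 + (m * u) ^ 2) := by gcongr
    _ = ((m * u) ^ p * (1 + (m * u) ^ 2) * ‖e (u * w)‖) * C' := by rw [mul_pow]; ring
    _ ≤ C * C' := by gcongr

theorem integrableOn_inv_one_add_mul_sq {m : ℝ} (hm : 0 < m) :
    IntegrableOn (fun u : ℝ => (1 + (m * u) ^ 2)⁻¹) (Ioi 0) := by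
  have := (integrableOn_Ioi_comp_mul_left_iff (fun x : ℝ => (1 + x ^ 2)⁻¹) 0 hm).2
    integrable_inv_one_add_sq.integrableOn
  exact this

theorem integral_inv_one_add_mul_sq {m : ℝ} (hm : 0 < m) :
    ∫ u in Ioi (0 : ℝ), (1 + (m * u) ^ 2)⁻¹ = m⁻¹ * (Real.pi / 2) := by
  rw [integral_comp_mul_left_Ioi (fun x : ℝ => (1 + x ^ 2)⁻¹) 0 hm]
  simp

theorem aestronglyMeasurable_kernel {e : ℂ → ℂ} {γ : ℝ} (he : ContinuousOn e (sector γ))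
    {w : ℂ} (hw : w ∈ sector γ) :
    AEStronglyMeasurable (fun u : ℝ => e (u * w)) (volume.restrict (Ioi 0)) := by
  refine ContinuousOn.aestronglyMeasurable ?_ measurableSet_Ioi
  exact he.comp (by fun_prop) fun u hu => ofReal_mul_mem_sector hw hu

theorem integrable_kernel_mul {e : ℂ → ℂ} {γ : ℝ} (he : ContinuousOn e (sector γ))
    {p : ℕ} {C C' : ℝ} (hC : ∀ z ∈ sector γ, ‖z‖ ^ p * (1 + ‖z‖ ^ 2) * ‖e z‖ ≤ C)
    {ψ : ℝ → ℂ} (hψm : AEStronglyMeasurable ψ (volume.restrict (Ioi 0)))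
    (hψ : ∀ u : ℝ, 0 < u → ‖ψ u‖ ≤ C' * u ^ p) {w : ℂ} (hw : w ∈ sector γ) :
    IntegrableOn (fun u : ℝ => e (u * w) * ψ u) (Ioi 0) := by
  have hw0 : 0 < ‖w‖ := norm_pos_iff.2 hw.1
  refine Integrable.mono' ((integrableOn_inv_one_add_mul_sq hw0).const_mul (C * C' / ‖w‖ ^ p))
    ((aestronglyMeasurable_kernel he hw).mul hψm) ?_
  filter_upwards [ae_restrict_mem measurableSet_Ioi] with u hu
  exact norm_kernel_mul_le hC hψ hw0 le_rfl hu (ofReal_mul_mem_sector hw hu)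

theorem norm_integral_kernel_mul_le {e : ℂ → ℂ} {γ : ℝ}
    {p : ℕ} {C C' : ℝ} (hC : ∀ z ∈ sector γ, ‖z‖ ^ p * (1 + ‖z‖ ^ 2) * ‖e z‖ ≤ C)
    {ψ : ℝ → ℂ} (hψ : ∀ u : ℝ, 0 < u → ‖ψ u‖ ≤ C' * u ^ p) {w : ℂ} (hw : w ∈ sector γ) :
    ‖∫ u in Ioi (0 : ℝ), e (u * w) * ψ u‖
      ≤ C * C' / ‖w‖ ^ p * (‖w‖⁻¹ * (Real.pi / 2)) := by
  have hw0 : 0 < ‖w‖ := norm_pos_iff.2 hw.1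
  rw [← integral_inv_one_add_mul_sq hw0, ← integral_const_mul]
  refine norm_integral_le_of_norm_le
    ((integrableOn_inv_one_add_mul_sq hw0).const_mul (C * C' / ‖w‖ ^ p)) ?_
  filter_upwards [ae_restrict_mem measurableSet_Ioi] with u hu
  exact norm_kernel_mul_le hC hψ hw0 le_rfl hu (ofReal_mul_mem_sector hw hu)

theorem differentiableOn_integral_kernel_mul {e : ℂ → ℂ} {γ : ℝ} (hγ : γ < 2)
    (he : DifferentiableOn ℂ e (sector γ))
    {p : ℕ} {C C' : ℝ} (hC : ∀ z ∈ sector γ, ‖z‖ ^ p * (1 + ‖z‖ ^ 2) * ‖e z‖ ≤ C)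
    {ψ : ℝ → ℂ} (hψm : AEStronglyMeasurable ψ (volume.restrict (Ioi 0)))
    (hψ : ∀ u : ℝ, 0 < u → ‖ψ u‖ ≤ C' * u ^ p) :
    DifferentiableOn ℂ (fun w : ℂ => ∫ u in Ioi (0 : ℝ), e (u * w) * ψ u) (sector γ) := by
  intro w₀ hw₀
  have hopen := isOpen_sector hγ
  have hn0 : 0 < ‖w₀‖ := norm_pos_iff.2 hw₀.1
  obtain ⟨r, hr, hball⟩ := Metric.isOpen_iff.1 hopen w₀ hw₀
  set ρ := min (r / 3) (‖w₀‖ / 4) with hρdef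
  have hρ : 0 < ρ := by positivity
  have hρr : 2 * ρ < r := by have := min_le_left (r / 3) (‖w₀‖ / 4); linarith
  have hρn : 2 * ρ ≤ ‖w₀‖ / 2 := by have := min_le_right (r / 3) (‖w₀‖ / 4); linarith
  set m := ‖w₀‖ / 2 with hm
  have hm0 : 0 < m := by positivity
  have hsub : ∀ w ∈ Metric.ball w₀ ρ, ∀ y ∈ Metric.closedBall w ρ, y ∈ sector γ ∧ m ≤ ‖y‖ := by
    intro w hw y hy
    have hd : dist y w₀ < 2 * ρ := by
      have := dist_triangle y w w₀
      rw [Metric.mem_ball] at hw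
      rw [Metric.mem_closedBall] at hy
      linarith
    refine ⟨hball (hd.trans hρr), ?_⟩
    rw [dist_eq_norm] at hd
    have := norm_sub_norm_le w₀ y
    rw [norm_sub_rev] at this
    linarith
  have hdiff : ∀ u : ℝ, 0 < u → ∀ w ∈ sector γ,
      HasDerivAt (fun w : ℂ => e (u * w) * ψ u) (deriv e (u * w) * u * ψ u) w := by
    intro u hu w hw
    have h1 : HasDerivAt e (deriv e (u * w)) (u * w) :=
      (he.differentiableAt (hopen.mem_nhds (ofReal_mul_mem_sector hw hu))).hasDerivAt
    have h2 : HasDerivAt (fun w : ℂ => (u : ℂ) * w) u w := by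
      simpa using (hasDerivAt_id w).const_mul (u : ℂ)
    exact (h1.comp w h2).mul_const _
  have hcd : ContinuousOn (deriv e) (sector γ) := (he.deriv hopen).continuousOn
  refine (hasDerivAt_integral_of_dominated_loc_of_deriv_le
    (F' := fun w u => deriv e (u * w) * u * ψ u)
    (bound := fun u : ℝ => C * C' / m ^ p * (1 + (m * u) ^ 2)⁻¹ / ρ)
    (Metric.ball_mem_nhds w₀ hρ) ?_ ?_ ?_ ?_ ?_ ?_).2.differentiableAt.differentiableWithinAt
  · filter_upwards [hopen.mem_nhds hw₀] with w hw
    exact (aestronglyMeasurable_kernel he.continuousOn hw).mul hψm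
  · exact integrable_kernel_mul he.continuousOn hC hψm hψ hw₀
  · exact ((aestronglyMeasurable_kernel hcd hw₀).mul
      (by fun_prop)).mul hψm
  · filter_upwards [ae_restrict_mem measurableSet_Ioi] with u hu w hw
    have hws := (hsub w hw w (Metric.mem_closedBall_self hρ.le)).1
    rw [← (hdiff u hu w hws).deriv]
    refine Complex.norm_deriv_le_of_forall_mem_sphere_norm_le hρ ?_ ?_
    · refine DifferentiableOn.diffContOnCl fun y hy => ?_
      exact (hdiff u hu y (hsub w hw y
        (Metric.closure_ball_subset_closedBall hy)).1).differentiableAt.differentiableWithinAt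
    · intro y hy
      have hy' := hsub w hw y (Metric.sphere_subset_closedBall hy)
      exact norm_kernel_mul_le hC hψ hm0 hy'.2 hu (ofReal_mul_mem_sector hy'.1 hu)
  · exact ((integrableOn_inv_one_add_mul_sq hm0).const_mul (C * C' / m ^ p)).div_const ρ
  · filter_upwards [ae_restrict_mem measurableSet_Ioi] with u hu w hw
    exact hdiff u hu w (hsub w hw w (Metric.mem_closedBall_self hρ.le)).1

/-- A geometrically bounded power series, truncated outside its disc of convergence, is
approximated by its partial sums on the whole half-line. -/
theorem exists_truncated_powerSeries {b : ℕ → ℂ} {C D : ℝ} (hD : 0 < D)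
    (hb : ∀ k, ‖b k‖ ≤ C * D ^ k) :
    ∃ ψ : ℝ → ℂ, Measurable ψ ∧ ∀ (p : ℕ) (u : ℝ), 0 < u →
      ‖ψ u - ∑ k ∈ Finset.range p, b k * (u : ℂ) ^ k‖ ≤ 2 * C * (2 * D) ^ p * u ^ p := by
  have hC : 0 ≤ C := by simpa using (norm_nonneg _).trans (hb 0)
  have hterm : ∀ (u : ℝ), 0 ≤ u → ∀ k, ‖b k * (u : ℂ) ^ k‖ ≤ C * (D * u) ^ k := by
    intro u hu k
    rw [norm_mul, norm_pow, Complex.norm_real, Real.norm_of_nonneg hu, mul_pow, ← mul_assoc]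
    gcongr
    exact hb k
  have hgeo : ∀ u : ℝ, 0 ≤ u → u ≤ 1 / (2 * D) → 0 ≤ D * u ∧ D * u ≤ 1 / 2 := by
    intro u hu hu'
    rw [le_div_iff₀ (by positivity)] at hu'
    exact ⟨by positivity, by linarith⟩
  have hsum : ∀ u : ℝ, 0 ≤ u → u ≤ 1 / (2 * D) → Summable fun k => b k * (u : ℂ) ^ k := by
    intro u hu hu'
    obtain ⟨h0, h1⟩ := hgeo u hu hu'
    exact Summable.of_norm_bounded
      ((summable_geometric_of_lt_one h0 (by linarith)).mul_left C) (hterm u hu)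
  refine ⟨(Icc 0 (1 / (2 * D))).indicator fun u => ∑' k, b k * (u : ℂ) ^ k, ?_, ?_⟩
  · refine measurable_of_tendsto_metrizable (f := fun n : ℕ =>
      (Icc 0 (1 / (2 * D))).indicator fun u : ℝ => ∑ k ∈ Finset.range n, b k * (u : ℂ) ^ k) ?_ ?_
    · intro n
      refine Measurable.indicator (Continuous.measurable ?_) measurableSet_Icc
      fun_prop
    · rw [tendsto_pi_nhds]
      intro u
      by_cases hu : u ∈ Icc 0 (1 / (2 * D))
      · simp only [indicator_of_mem hu]
        exact (hsum u hu.1 hu.2).hasSum.tendsto_sum_nat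
      · simp only [indicator_of_notMem hu]
        exact tendsto_const_nhds
  · intro p u hu
    rw [mul_assoc, ← mul_pow]
    by_cases hu' : u ≤ 1 / (2 * D)
    · obtain ⟨h0, h1⟩ := hgeo u hu.le hu'
      rw [indicator_of_mem (show u ∈ Icc 0 (1 / (2 * D)) from ⟨hu.le, hu'⟩), ← (hsum u hu.le hu').sum_add_tsum_nat_add p,
        add_sub_cancel_left]
      have hs : HasSum (fun k => C * (D * u) ^ p * (D * u) ^ k)
          (C * (D * u) ^ p * (1 - D * u)⁻¹) :=
        (hasSum_geometric_of_lt_one h0 (by linarith)).mul_left _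
      refine (tsum_of_norm_bounded hs fun k => ?_).trans ?_
      · refine (hterm u hu.le (k + p)).trans (le_of_eq ?_)
        rw [pow_add]
        ring
      · have h2 : (1 - D * u)⁻¹ ≤ 2 := by
          rw [inv_le_comm₀ (by linarith) (by norm_num)]
          linarith
        have h3 : (D * u) ^ p ≤ (2 * D * u) ^ p := by
          gcongr
          nlinarith
        have h4 : 0 ≤ (1 - D * u)⁻¹ := inv_nonneg.2 (by linarith)
        calc C * (D * u) ^ p * (1 - D * u)⁻¹ ≤ C * (2 * D * u) ^ p * 2 := by gcongr
          _ = 2 * C * (2 * D * u) ^ p := by ring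
    · rw [indicator_of_notMem (fun h => hu' h.2), zero_sub, norm_neg]
      have hx : 1 ≤ 2 * D * u := by
        rw [not_le, div_lt_iff₀ (by positivity)] at hu'
        linarith
      calc ‖∑ k ∈ Finset.range p, b k * (u : ℂ) ^ k‖
          ≤ ∑ k ∈ Finset.range p, C * (2 * D * u) ^ p * (1 / 2) ^ k := by
            refine norm_sum_le_of_le _ fun k hk => (hterm u hu.le k).trans ?_
            have : (D * u) ^ k = (2 * D * u) ^ k * (1 / 2) ^ k := by
              rw [← mul_pow]
              congr 1
              ring
            rw [this, ← mul_assoc]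
            have := pow_le_pow_right₀ hx (Finset.mem_range.1 hk).le
            gcongr
        _ = C * (2 * D * u) ^ p * ∑ k ∈ Finset.range p, (1 / 2 : ℝ) ^ k := by
            rw [Finset.mul_sum]
        _ ≤ C * (2 * D * u) ^ p * 2 := by
            gcongr
            exact sum_geometric_two_le p
        _ = 2 * C * (2 * D * u) ^ p := by ring

theorem mul_integral_kernel_pow {e : ℂ → ℂ} {γ : ℝ} (hγ0 : 0 < γ) (hγ : γ < 2)
    (he : DifferentiableOn ℂ e (sector γ)) {e₀ : ℝ → ℝ} (he₀ : ∀ u : ℝ, 0 < u → e u = e₀ u)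
    {k : ℕ} {C : ℝ} (hC : ∀ z ∈ sector γ, ‖z‖ ^ k * (1 + ‖z‖ ^ 2) * ‖e z‖ ≤ C)
    {w : ℂ} (hw : w ∈ sector γ) :
    w * ∫ u in Ioi (0 : ℝ), e (u * w) * (u : ℂ) ^ k
      = ((∫ u in Ioi (0 : ℝ), u ^ k * e₀ u : ℝ) : ℂ) * w⁻¹ ^ k := by
  set c : ℂ := ((∫ u in Ioi (0 : ℝ), u ^ k * e₀ u : ℝ) : ℂ) with hc
  have hopen := isOpen_sector hγ
  have hI := differentiableOn_integral_kernel_mul (ψ := fun u : ℝ => (u : ℂ) ^ k) (C' := 1)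
    hγ he hC (by fun_prop) (by
      intro u hu
      rw [norm_pow, Complex.norm_real, Real.norm_of_nonneg hu.le, one_mul])
  have hG : DifferentiableOn ℂ
      (fun w : ℂ => w ^ (k + 1) * ∫ u in Ioi (0 : ℝ), e (u * w) * (u : ℂ) ^ k) (sector γ) :=
    (differentiableOn_id.pow _).mul hI
  have hreal : ∀ t : ℝ, 0 < t →
      (t : ℂ) ^ (k + 1) * ∫ u in Ioi (0 : ℝ), e (u * t) * (u : ℂ) ^ k = c := by
    intro t ht
    have h1 : ∫ u in Ioi (0 : ℝ), e (u * t) * (u : ℂ) ^ k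
        = ((∫ u in Ioi (0 : ℝ), e₀ (t * u) * u ^ k : ℝ) : ℂ) := by
      rw [← integral_complex_ofReal]
      refine setIntegral_congr_fun measurableSet_Ioi fun u hu => ?_
      have hu0 : 0 < t * u := mul_pos ht hu
      have := he₀ _ hu0
      push_cast at this ⊢
      rw [mul_comm (u : ℂ) (t : ℂ), this]
    have h2 := integral_comp_mul_left_Ioi (fun x : ℝ => x ^ k * e₀ x) 0 ht
    rw [mul_zero, smul_eq_mul] at h2
    have h3 : ∫ u in Ioi (0 : ℝ), (t * u) ^ k * e₀ (t * u)
        = t ^ k * ∫ u in Ioi (0 : ℝ), e₀ (t * u) * u ^ k := by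
      rw [← integral_const_mul]
      refine integral_congr_ae (Eventually.of_forall fun u => ?_)
      simp only [mul_pow]
      ring
    rw [h3] at h2
    rw [h1, hc]
    norm_cast
    rw [pow_succ', mul_assoc, h2, mul_inv_cancel_left₀ ht.ne']
  have h1mem : (1 : ℂ) ∈ sector γ := by
    simpa using ofReal_mem_sector hγ0 one_pos
  have hfreq : ∃ᶠ z in nhdsWithin (1 : ℂ) {1}ᶜ,
      z ^ (k + 1) * (∫ u in Ioi (0 : ℝ), e (u * z) * (u : ℂ) ^ k) = c := by
    have ht : Tendsto (fun x : ℝ => (x : ℂ)) (nhdsWithin 1 (Ioi 1)) (nhdsWithin 1 {1}ᶜ) := by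
      refine tendsto_nhdsWithin_iff.2 ⟨?_, ?_⟩
      · exact (Complex.continuous_ofReal.tendsto' 1 1 (by simp)).mono_left nhdsWithin_le_nhds
      · filter_upwards [self_mem_nhdsWithin] with x hx
        have : x ≠ 1 := ne_of_gt hx
        simpa using this
    refine ht.frequently (Eventually.frequently ?_)
    filter_upwards [self_mem_nhdsWithin] with x hx
    exact hreal x (zero_lt_one.trans hx)
  have heq := (hG.analyticOnNhd hopen).eqOn_of_preconnected_of_frequently_eq
    (analyticOnNhd_const (v := c)) (isPreconnected_sector hγ) h1mem hfreq hw
  have hw0 := hw.1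
  simp only at heq
  rw [inv_pow, ← heq, pow_succ]
  field_simp

/-- The truncated Laplace transform of a formal Borel transform, with a general kernel `e` having
the given moments. -/
theorem exists_asymptotic_of_kernel {γ : ℝ} (hγ0 : 0 < γ) (hγ : γ < 2)
    {e : ℂ → ℂ} (he : DifferentiableOn ℂ e (sector γ))
    {e₀ : ℝ → ℝ} (he₀ : ∀ u : ℝ, 0 < u → e u = e₀ u) (𝓜 : Set (ℕ → ℝ)) (hne : 𝓜.Nonempty)
    (hdecay : ∀ M ∈ 𝓜, ∀ H : ℝ, 1 ≤ H → ∃ C : ℝ, ∀ (p : ℕ), ∀ z ∈ sector γ,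
      H ^ p * (‖z‖ ^ p * (1 + ‖z‖ ^ 2) * (p.factorial * ‖e z‖)) ≤ C * M p)
    {lam : ℕ → ℂ} {A D : ℝ} (hD : 0 < D)
    (hmom : ∀ p : ℕ, 0 < ∫ u in Ioi (0 : ℝ), u ^ p * e₀ u)
    (hlam : ∀ p : ℕ, ‖lam p‖
      ≤ A * D ^ p * (p.factorial * ∫ u in Ioi (0 : ℝ), u ^ p * e₀ u)) :
    ∃ f : ℂ → ℂ, DifferentiableOn ℂ f (sector γ) ∧
      ∀ M ∈ 𝓜, ∀ H : ℝ, 1 ≤ H → ∃ C : ℝ, ∀ (p : ℕ), ∀ z ∈ sector γ,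
        ‖f z - ∑ k ∈ Finset.range p, lam k / k.factorial * z ^ k‖
          ≤ C * M p / (p.factorial * H ^ p) * ‖z‖ ^ p := by
  set mom : ℕ → ℝ := fun p => ∫ u in Ioi (0 : ℝ), u ^ p * e₀ u with hmomdef
  set b : ℕ → ℂ := fun k => lam k / (k.factorial * mom k) with hbdef
  have hfac : ∀ p : ℕ, (0 : ℝ) < p.factorial := fun p => by exact_mod_cast p.factorial_pos
  have hb : ∀ k, ‖b k‖ ≤ A * D ^ k := by
    intro k
    have hk := hmom k
    have hpos : 0 < (k.factorial : ℝ) * mom k := mul_pos (hfac k) hk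
    have : ‖(k.factorial : ℂ) * (mom k : ℂ)‖ = k.factorial * mom k := by
      rw [norm_mul, Complex.norm_real, Complex.norm_natCast, Real.norm_of_nonneg hk.le]
    rw [hbdef, norm_div, this, div_le_iff₀ hpos]
    exact hlam k
  have hA : 0 ≤ A := by simpa using (norm_nonneg _).trans (hb 0)
  obtain ⟨ψ, hψm, hψ⟩ := exists_truncated_powerSeries hD hb
  have hsingle : ∀ p : ℕ, ∃ C : ℝ, ∀ z ∈ sector γ, ‖z‖ ^ p * (1 + ‖z‖ ^ 2) * ‖e z‖ ≤ C := by
    intro p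
    obtain ⟨M, hM⟩ := hne
    obtain ⟨C, hC⟩ := hdecay M hM 1 le_rfl
    refine ⟨C * M p / p.factorial, fun z hz => ?_⟩
    rw [le_div_iff₀ (hfac p)]
    have := hC p z hz
    rw [one_pow, one_mul] at this
    linarith
  have hψ0 : ∀ u : ℝ, 0 < u → ‖ψ u‖ ≤ 2 * A * u ^ 0 := by
    intro u hu
    simpa using hψ 0 u hu
  have hpow : ∀ (k : ℕ) (u : ℝ), 0 < u → ‖(u : ℂ) ^ k‖ ≤ 1 * u ^ k := by
    intro k u hu
    rw [norm_pow, Complex.norm_real, Real.norm_of_nonneg hu.le, one_mul]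
  refine ⟨fun z => z⁻¹ * ∫ u in Ioi (0 : ℝ), e (u * z⁻¹) * ψ u, ?_, ?_⟩
  · obtain ⟨C, hC⟩ := hsingle 0
    have h1 : DifferentiableOn ℂ (fun w : ℂ => w * ∫ u in Ioi (0 : ℝ), e (u * w) * ψ u)
        (sector γ) :=
      differentiableOn_id.mul
        (differentiableOn_integral_kernel_mul hγ he hC hψm.aestronglyMeasurable hψ0)
    exact h1.comp (differentiableOn_inv.mono fun z hz => hz.1) fun z hz => inv_mem_sector hz
  · intro M hM H hH
    have h2D : 0 < 2 * D := by positivity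
    obtain ⟨C, hC⟩ := hdecay M hM (2 * D * H + 1) (by
      have : 0 ≤ 2 * D * H := by positivity
      linarith)
    refine ⟨C * (2 * A) * (Real.pi / 2), fun p z hz => ?_⟩
    have hw := inv_mem_sector hz
    have hz0 : 0 < ‖z‖ := norm_pos_iff.2 hz.1
    have hpoly : ∑ k ∈ Finset.range p, lam k / k.factorial * z ^ k
        = z⁻¹ * ∫ u in Ioi (0 : ℝ),
          e (u * z⁻¹) * ∑ k ∈ Finset.range p, b k * (u : ℂ) ^ k := by
      have hInt : ∀ k ∈ Finset.range p,
          Integrable (fun u : ℝ => b k * (e (u * z⁻¹) * (u : ℂ) ^ k))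
            (volume.restrict (Ioi 0)) := by
        intro k _
        obtain ⟨C, hC⟩ := hsingle k
        exact (integrable_kernel_mul he.continuousOn hC (by fun_prop) (hpow k) hw).const_mul _
      have h1 : ∀ u : ℝ, e (u * z⁻¹) * ∑ k ∈ Finset.range p, b k * (u : ℂ) ^ k
          = ∑ k ∈ Finset.range p, b k * (e (u * z⁻¹) * (u : ℂ) ^ k) := by
        intro u
        rw [Finset.mul_sum]
        refine Finset.sum_congr rfl fun k _ => ?_
        ring
      simp only [h1]
      rw [integral_finsetSum _ hInt, Finset.mul_sum]
      refine Finset.sum_congr rfl fun k _ => ?_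
      obtain ⟨C, hC⟩ := hsingle k
      have h2 := mul_integral_kernel_pow hγ0 hγ he he₀ hC hw
      rw [inv_inv] at h2
      rw [integral_const_mul, mul_left_comm, h2, hbdef]
      have hk : (mom k : ℂ) ≠ 0 := by exact_mod_cast (hmom k).ne'
      have hk' : (k.factorial : ℂ) ≠ 0 := by exact_mod_cast (hfac k).ne'
      simp only [hmomdef] at hk ⊢
      field_simp
    obtain ⟨C₀, hC₀⟩ := hsingle 0
    obtain ⟨C₁, hC₁⟩ := hsingle p
    have hψI := integrable_kernel_mul he.continuousOn hC₀ hψm.aestronglyMeasurable hψ0 hw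
    have hdm : Measurable fun u : ℝ => ψ u - ∑ k ∈ Finset.range p, b k * (u : ℂ) ^ k :=
      hψm.sub (by fun_prop)
    have hdI := integrable_kernel_mul he.continuousOn hC₁ hdm.aestronglyMeasurable (hψ p) hw
    have hpI : Integrable (fun u : ℝ => e (u * z⁻¹) * ∑ k ∈ Finset.range p, b k * (u : ℂ) ^ k)
        (volume.restrict (Ioi 0)) := by
      refine (hψI.sub hdI).congr (Eventually.of_forall fun u => ?_)
      simp only [Pi.sub_apply]
      ring
    have hdiff : z⁻¹ * (∫ u in Ioi (0 : ℝ), e (u * z⁻¹) * ψ u)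
        - ∑ k ∈ Finset.range p, lam k / k.factorial * z ^ k
        = z⁻¹ * ∫ u in Ioi (0 : ℝ),
          e (u * z⁻¹) * (ψ u - ∑ k ∈ Finset.range p, b k * (u : ℂ) ^ k) := by
      rw [hpoly, ← mul_sub, ← integral_sub hψI hpI]
      simp only [mul_sub]
    have hCp : ∀ y ∈ sector γ, ‖y‖ ^ p * (1 + ‖y‖ ^ 2) * ‖e y‖
        ≤ C * M p / (p.factorial * (2 * D * H) ^ p) := by
      intro y hy
      rw [le_div_iff₀ (mul_pos (hfac p) (by positivity))]
      refine le_trans ?_ (hC p y hy)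
      calc ‖y‖ ^ p * (1 + ‖y‖ ^ 2) * ‖e y‖ * (p.factorial * (2 * D * H) ^ p)
          = (2 * D * H) ^ p * (‖y‖ ^ p * (1 + ‖y‖ ^ 2) * (p.factorial * ‖e y‖)) := by ring
        _ ≤ _ := by
          gcongr
          linarith
    rw [hdiff, norm_mul, norm_inv]
    have hfin := norm_integral_kernel_mul_le hCp (hψ p) hw
    rw [norm_inv, inv_inv, inv_pow, div_inv_eq_mul] at hfin
    calc ‖z‖⁻¹ * _ ≤ ‖z‖⁻¹ * _ := mul_le_mul_of_nonneg_left hfin (by positivity)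
      _ = _ := by
        have := (hfac p).ne'
        field_simp
        ring

/-- Surjectivity of the Borel map on ultraholomorphic classes defined by a family of weight
sequences, from a kernel adapted to the given formal series. -/
theorem exists_borel_of_kernel {γ γ' : ℝ} (hγ0 : 0 < γ) (hγγ' : γ < γ') (hγ' : γ' < 2)
    {e : ℂ → ℂ} (he : DifferentiableOn ℂ e (sector γ'))
    {e₀ : ℝ → ℝ} (he₀ : ∀ u : ℝ, 0 < u → e u = e₀ u) (𝓜 : Set (ℕ → ℝ)) (hne : 𝓜.Nonempty)
    (hpos : ∀ M ∈ 𝓜, ∀ p, 0 < M p)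
    (hdecay : ∀ M ∈ 𝓜, ∀ H : ℝ, 1 ≤ H → ∃ C : ℝ, ∀ (p : ℕ), ∀ z ∈ sector γ',
      H ^ p * (‖z‖ ^ p * (1 + ‖z‖ ^ 2) * (p.factorial * ‖e z‖)) ≤ C * M p)
    {lam : ℕ → ℂ} {A D : ℝ} (hD : 0 < D)
    (hmom : ∀ p : ℕ, 0 < ∫ u in Ioi (0 : ℝ), u ^ p * e₀ u)
    (hlam : ∀ p : ℕ, ‖lam p‖
      ≤ A * D ^ p * (p.factorial * ∫ u in Ioi (0 : ℝ), u ^ p * e₀ u)) :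
    ∃ f : ℂ → ℂ, DifferentiableOn ℂ f (sector γ) ∧
      (∀ M ∈ 𝓜, ∃ C : ℝ, ∀ z ∈ sector γ, ∀ p : ℕ, ‖iteratedDeriv p f z‖ ≤ C * M p) ∧
      (∀ p : ℕ, Tendsto (iteratedDeriv p f) (nhdsWithin 0 (sector γ)) (nhds (lam p))) := by
  obtain ⟨f, hf, hrem⟩ := exists_asymptotic_of_kernel (hγ0.trans hγγ') hγ' he he₀ 𝓜 hne hdecay hD
    hmom hlam
  obtain ⟨ε, hε, -, hball⟩ := exists_closedBall_subset_sector hγγ' hγ'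
  have hopen := isOpen_sector hγ'
  have hfac : ∀ p : ℕ, (0 : ℝ) < p.factorial := fun p => by exact_mod_cast p.factorial_pos
  refine ⟨f, hf.mono (sector_mono hγγ'.le), ?_, ?_⟩
  · intro M hM
    obtain ⟨C, hC⟩ := hrem M hM ((1 + ε) / ε) (by rw [le_div_iff₀ hε]; linarith)
    refine ⟨|C|, fun z hz p => ?_⟩
    have hz0 : 0 < ‖z‖ := norm_pos_iff.2 hz.1
    have hMp := hpos M hM p
    have hB : 0 ≤ |C| * M p / (p.factorial * ((1 + ε) / ε) ^ p) := by positivity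
    have h1 := norm_iteratedDeriv_sub_le_of_remainder hopen hf (fun k => lam k / k.factorial) hε
      hz.1 (hball z hz) p p hB (by
        intro y hy
        refine (hC p y hy).trans ?_
        gcongr
        exact le_abs_self C)
    have hzero : ∑ k ∈ Finset.range p,
        lam k / k.factorial * ((k.descFactorial p : ℂ) * z ^ (k - p)) = 0 := by
      refine Finset.sum_eq_zero fun k hk => ?_
      rw [Nat.descFactorial_of_lt (Finset.mem_range.1 hk)]
      simp
    rw [hzero, sub_zero] at h1
    refine h1.trans (le_of_eq ?_)
    have := (hfac p).ne'
    rw [mul_pow, mul_pow, div_pow]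
    field_simp
  · intro p
    obtain ⟨M, hM⟩ := hne
    obtain ⟨C, hC⟩ := hrem M hM 1 le_rfl
    set B : ℝ := |C| * M (p + 1) / ((p + 1).factorial * 1 ^ (p + 1)) with hBdef
    have hMp := hpos M hM (p + 1)
    have hB : 0 ≤ B := by positivity
    rw [tendsto_iff_norm_sub_tendsto_zero]
    have hlim : Tendsto (fun z : ℂ => p.factorial * (B * (1 + ε) ^ (p + 1)) / ε ^ p * ‖z‖)
        (nhdsWithin 0 (sector γ)) (nhds 0) := by
      have : Tendsto (fun z : ℂ => p.factorial * (B * (1 + ε) ^ (p + 1)) / ε ^ p * ‖z‖)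
          (nhds 0) (nhds 0) := by
        refine Continuous.tendsto' (by fun_prop) _ _ (by simp)
      exact this.mono_left nhdsWithin_le_nhds
    refine squeeze_zero' (Eventually.of_forall fun z => norm_nonneg _) ?_ hlim
    filter_upwards [self_mem_nhdsWithin] with z hz
    have hz0 : 0 < ‖z‖ := norm_pos_iff.2 hz.1
    have h1 := norm_iteratedDeriv_sub_le_of_remainder hopen hf (fun k => lam k / k.factorial) hε
      hz.1 (hball z hz) p (p + 1) hB (by
        intro y hy
        refine (hC (p + 1) y hy).trans ?_
        rw [hBdef]
        gcongr
        exact le_abs_self C)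
    have hval : ∑ k ∈ Finset.range (p + 1),
        lam k / k.factorial * ((k.descFactorial p : ℂ) * z ^ (k - p)) = lam p := by
      rw [Finset.sum_range_succ, Finset.sum_eq_zero, zero_add, Nat.descFactorial_self]
      · have : (p.factorial : ℂ) ≠ 0 := by exact_mod_cast (hfac p).ne'
        simp only [Nat.sub_self, pow_zero, mul_one]
        field_simp
      · intro k hk
        rw [Nat.descFactorial_of_lt (Finset.mem_range.1 hk)]
        simp
    rw [hval] at h1
    refine h1.trans (le_of_eq ?_)
    rw [mul_pow, mul_pow]
    field_simp
    ring

theorem norm_div_one_add_sq_le {x : ℂ} (hx : 0 ≤ x.re) : ‖x / (1 + x) ^ 2‖ ≤ ‖x‖ := by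
  have h1 : 1 ≤ ‖1 + x‖ := by
    refine le_trans ?_ (Complex.re_le_norm (1 + x))
    simpa using hx
  rw [norm_div, norm_pow]
  exact div_le_self (norm_nonneg _) (one_le_pow₀ h1)

theorem norm_div_one_add_sq_le_inv {x : ℂ} (hx : 0 ≤ x.re) : ‖x / (1 + x) ^ 2‖ ≤ ‖x‖⁻¹ := by
  rcases eq_or_ne x 0 with rfl | h0
  · simp
  have h1 : ‖x‖ ≤ ‖1 + x‖ := by
    refine abs_le_of_sq_le_sq' ?_ (norm_nonneg _) |>.2
    rw [← Complex.normSq_eq_norm_sq, ← Complex.normSq_eq_norm_sq, Complex.normSq_apply,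
      Complex.normSq_apply]
    simp only [Complex.add_re, Complex.add_im, Complex.one_re, Complex.one_im]
    nlinarith
  have h2 : 0 < ‖x‖ := norm_pos_iff.2 h0
  have h3 : 0 < ‖1 + x‖ := h2.trans_le h1
  rw [norm_div, norm_pow, div_le_iff₀ (by positivity)]
  calc ‖x‖ = ‖x‖⁻¹ * ‖x‖ ^ 2 := by field_simp
    _ ≤ ‖x‖⁻¹ * ‖1 + x‖ ^ 2 := by gcongr

theorem le_re_div_one_add_sq {x : ℂ} {δ : ℝ} (hδ : 0 ≤ δ) (hδ1 : δ ≤ 1)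
    (hx : δ * ‖x‖ ≤ x.re) :
    δ * (‖x‖ / (1 + ‖x‖) ^ 2) ≤ (x / (1 + x) ^ 2).re := by
  have hn : ‖x‖ ^ 2 = x.re * x.re + x.im * x.im := by
    rw [← Complex.normSq_eq_norm_sq, Complex.normSq_apply]
  have hr := norm_nonneg x
  have hre : 0 ≤ x.re := le_trans (by positivity) hx
  have hrn : x.re ≤ ‖x‖ := Complex.re_le_norm x
  have hval : (x / (1 + x) ^ 2).re
      = (x.re * (1 + ‖x‖ ^ 2) + 2 * ‖x‖ ^ 2) / (1 + 2 * x.re + ‖x‖ ^ 2) ^ 2 := by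
    have hsq : Complex.normSq ((1 + x) ^ 2) = (1 + 2 * x.re + ‖x‖ ^ 2) ^ 2 := by
      rw [map_pow, Complex.normSq_apply, hn]
      simp only [Complex.add_re, Complex.add_im, Complex.one_re, Complex.one_im]
      ring
    rw [Complex.div_re, hsq, ← add_div, hn]
    congr 1
    simp only [pow_two, Complex.mul_re, Complex.mul_im, Complex.add_re, Complex.add_im,
      Complex.one_re, Complex.one_im]
    ring
  rw [hval, ← mul_div_assoc]
  have h1 : δ * ‖x‖ * (1 + ‖x‖) ^ 2 ≤ x.re * (1 + ‖x‖ ^ 2) + 2 * ‖x‖ ^ 2 := by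
    have := mul_le_mul_of_nonneg_right hx (show 0 ≤ 1 + ‖x‖ ^ 2 by positivity)
    nlinarith [sq_nonneg ‖x‖]
  calc δ * ‖x‖ / (1 + ‖x‖) ^ 2
      = δ * ‖x‖ * (1 + ‖x‖) ^ 2 / ((1 + ‖x‖) ^ 2) ^ 2 := by
        have : 1 + ‖x‖ ≠ 0 := by positivity
        field_simp
    _ ≤ (x.re * (1 + ‖x‖ ^ 2) + 2 * ‖x‖ ^ 2) / ((1 + ‖x‖) ^ 2) ^ 2 := by gcongr
    _ ≤ _ := by
        have : 1 + 2 * x.re + ‖x‖ ^ 2 ≤ (1 + ‖x‖) ^ 2 := by nlinarith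
        gcongr

/-- A series of dilations of `X ↦ X / (1 + X) ^ 2`; its real part is comparable with
`σ n` for `‖X‖` near `τ n`. -/
noncomputable def dilationSeries (σ τ : ℕ → ℝ) (X : ℂ) : ℂ :=
  ∑' j, (σ j : ℂ) * ((X / τ j) / (1 + X / τ j) ^ 2)

section dilationSeries

variable {σ τ : ℕ → ℝ} {ν η : ℝ}

theorem div_le_pow_mul_div (hη0 : 0 ≤ η) (hη : ∀ j, σ (j + 1) / τ (j + 1) ≤ η * (σ j / τ j))
    (n k : ℕ) : σ (k + n) / τ (k + n) ≤ η ^ k * (σ n / τ n) := by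
  induction k with
  | zero => simp
  | succ k ih =>
    rw [show k + 1 + n = k + n + 1 by ring, pow_succ']
    refine (hη _).trans ?_
    rw [mul_assoc]
    gcongr

theorem le_pow_mul_of_le_mul_succ (hν0 : 0 ≤ ν) (hν : ∀ j, τ j ≤ ν * τ (j + 1)) (j k : ℕ) :
    τ j ≤ ν ^ k * τ (j + k) := by
  induction k with
  | zero => simp
  | succ k ih =>
    refine ih.trans ?_
    rw [pow_succ, mul_assoc]
    gcongr
    exact hν _

theorem norm_dilation_term_le (hσ : ∀ j, 0 < σ j) (hτ : ∀ j, 0 < τ j) {X : ℂ} (hX : 0 ≤ X.re)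
    (j : ℕ) : ‖(σ j : ℂ) * ((X / τ j) / (1 + X / τ j) ^ 2)‖ ≤ ‖X‖ * (σ j / τ j) := by
  have h0 : 0 ≤ (X / τ j).re := by
    rw [Complex.div_ofReal_re]
    exact div_nonneg hX (hτ j).le
  rw [norm_mul, Complex.norm_real, Real.norm_of_nonneg (hσ j).le]
  calc σ j * _ ≤ σ j * ‖X / τ j‖ :=
        mul_le_mul_of_nonneg_left (norm_div_one_add_sq_le h0) (hσ j).le
    _ = _ := by
      rw [norm_div, Complex.norm_real, Real.norm_of_nonneg (hτ j).le]
      ring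

theorem norm_dilation_term_le' (hσ : ∀ j, 0 < σ j) (hτ : ∀ j, 0 < τ j) {X : ℂ} (hX : 0 ≤ X.re)
    (j : ℕ) : ‖(σ j : ℂ) * ((X / τ j) / (1 + X / τ j) ^ 2)‖ ≤ σ j * (τ j / ‖X‖) := by
  have h0 : 0 ≤ (X / τ j).re := by
    rw [Complex.div_ofReal_re]
    exact div_nonneg hX (hτ j).le
  rw [norm_mul, Complex.norm_real, Real.norm_of_nonneg (hσ j).le]
  calc σ j * _ ≤ σ j * ‖X / τ j‖⁻¹ :=
        mul_le_mul_of_nonneg_left (norm_div_one_add_sq_le_inv h0) (hσ j).le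
    _ = _ := by
      rw [norm_div, Complex.norm_real, Real.norm_of_nonneg (hτ j).le, inv_div]

theorem summable_div (hσ : ∀ j, 0 < σ j) (hτ : ∀ j, 0 < τ j) (hη0 : 0 ≤ η) (hη1 : η < 1)
    (hη : ∀ j, σ (j + 1) / τ (j + 1) ≤ η * (σ j / τ j)) : Summable fun j => σ j / τ j :=
  Summable.of_nonneg_of_le (fun j => (div_pos (hσ j) (hτ j)).le)
    (fun j => div_le_pow_mul_div hη0 hη 0 j)
    ((summable_geometric_of_lt_one hη0 hη1).mul_right _)

theorem summable_dilation (hσ : ∀ j, 0 < σ j) (hτ : ∀ j, 0 < τ j) (hη0 : 0 ≤ η) (hη1 : η < 1)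
    (hη : ∀ j, σ (j + 1) / τ (j + 1) ≤ η * (σ j / τ j)) {X : ℂ} (hX : 0 ≤ X.re) :
    Summable fun j => (σ j : ℂ) * ((X / τ j) / (1 + X / τ j) ^ 2) :=
  Summable.of_norm_bounded ((summable_div hσ hτ hη0 hη1 hη).mul_left ‖X‖)
    (norm_dilation_term_le hσ hτ hX)

theorem differentiableOn_dilationSeries (hσ : ∀ j, 0 < σ j) (hτ : ∀ j, 0 < τ j) (hη0 : 0 ≤ η)
    (hη1 : η < 1) (hη : ∀ j, σ (j + 1) / τ (j + 1) ≤ η * (σ j / τ j)) :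
    DifferentiableOn ℂ (dilationSeries σ τ) {X | 0 < X.re} := by
  have hopen : IsOpen {X : ℂ | 0 < X.re} := isOpen_lt continuous_const Complex.continuous_re
  intro X hX
  have hU : IsOpen ({X : ℂ | 0 < X.re} ∩ Metric.ball X 1) := hopen.inter Metric.isOpen_ball
  have hmem : X ∈ {X : ℂ | 0 < X.re} ∩ Metric.ball X 1 := ⟨hX, Metric.mem_ball_self one_pos⟩
  have h := Complex.differentiableOn_tsum_of_summable_norm
    (F := fun (j : ℕ) (X : ℂ) => (σ j : ℂ) * ((X / τ j) / (1 + X / τ j) ^ 2))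
    ((summable_div hσ hτ hη0 hη1 hη).mul_left (‖X‖ + 1)) ?_ hU ?_
  · exact (h.differentiableAt (hU.mem_nhds hmem)).differentiableWithinAt
  · intro j Y hY
    have hne : (1 + Y / τ j) ^ 2 ≠ 0 := by
      refine pow_ne_zero _ fun h0 => ?_
      have h1 := congrArg Complex.re h0
      rw [Complex.add_re, Complex.div_ofReal_re, Complex.one_re, Complex.zero_re] at h1
      have h2 : 0 < Y.re / τ j := div_pos hY.1 (hτ j)
      linarith
    refine DifferentiableAt.differentiableWithinAt ?_
    fun_prop (disch := exact hne)
  · intro j Y hY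
    refine (norm_dilation_term_le hσ hτ (le_of_lt hY.1) j).trans ?_
    have h1 : ‖Y‖ ≤ ‖X‖ + 1 := by
      have h2 : ‖Y - X‖ < 1 := by rw [← dist_eq_norm]; exact hY.2
      have := norm_le_norm_add_norm_sub' Y X
      linarith
    have := (div_pos (hσ j) (hτ j)).le
    gcongr

theorem le_re_dilationSeries (hσ : ∀ j, 0 < σ j) (hτ : ∀ j, 0 < τ j) (hη0 : 0 ≤ η) (hη1 : η < 1)
    (hη : ∀ j, σ (j + 1) / τ (j + 1) ≤ η * (σ j / τ j)) {δ : ℝ} (hδ : 0 ≤ δ) (hδ1 : δ ≤ 1)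
    {X : ℂ} (hX : δ * ‖X‖ ≤ X.re) (n : ℕ) :
    σ n * (δ * ((‖X‖ / τ n) / (1 + ‖X‖ / τ n) ^ 2)) ≤ (dilationSeries σ τ X).re := by
  have hX0 : 0 ≤ X.re := le_trans (by positivity) hX
  have hs := summable_dilation hσ hτ hη0 hη1 hη hX0
  have hterm : ∀ j, σ j * (δ * ((‖X‖ / τ j) / (1 + ‖X‖ / τ j) ^ 2))
      ≤ ((σ j : ℂ) * ((X / τ j) / (1 + X / τ j) ^ 2)).re := by
    intro j
    have hj := hτ j
    have hnorm : ‖X / τ j‖ = ‖X‖ / τ j := by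
      rw [norm_div, Complex.norm_real, Real.norm_of_nonneg hj.le]
    have h1 : δ * ‖X / τ j‖ ≤ (X / τ j).re := by
      rw [Complex.div_ofReal_re, hnorm, ← mul_div_assoc]
      gcongr
    have h2 := le_re_div_one_add_sq hδ hδ1 h1
    rw [hnorm] at h2
    rw [Complex.re_ofReal_mul]
    exact mul_le_mul_of_nonneg_left h2 (hσ j).le
  rw [dilationSeries, Complex.re_tsum hs]
  refine (hterm n).trans ((Complex.hasSum_re hs.hasSum).summable.le_tsum n fun j _ => ?_)
  refine le_trans ?_ (hterm j)
  have := hσ j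
  have := hτ j
  positivity

theorem dilationSeries_ofReal (σ τ : ℕ → ℝ) (R : ℝ) :
    dilationSeries σ τ R = ((dilationSeries σ τ R).re : ℂ) := by
  have : dilationSeries σ τ R = ((∑' j, σ j * ((R / τ j) / (1 + R / τ j) ^ 2) : ℝ) : ℂ) := by
    rw [dilationSeries, Complex.ofReal_tsum]
    refine tsum_congr fun j => ?_
    push_cast
    rfl
  rw [this, Complex.ofReal_re]

theorem norm_dilationSeries_le (hσ : ∀ j, 0 < σ j) (hτ : ∀ j, 0 < τ j) (hmono : Monotone σ)
    (hν0 : 0 ≤ ν) (hν1 : ν < 1) (hν : ∀ j, τ j ≤ ν * τ (j + 1)) (hη0 : 0 ≤ η) (hη1 : η < 1)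
    (hη : ∀ j, σ (j + 1) / τ (j + 1) ≤ η * (σ j / τ j)) {X : ℂ} (hX : 0 ≤ X.re) {n : ℕ} {Q : ℝ}
    (h1 : τ n ≤ ‖X‖) (h2 : ‖X‖ ≤ Q * τ n) :
    ‖dilationSeries σ τ X‖ ≤ ((1 - ν)⁻¹ + Q * (1 - η)⁻¹) * σ n := by
  have hs := summable_dilation hσ hτ hη0 hη1 hη hX
  have hX0 : 0 < ‖X‖ := (hτ n).trans_le h1
  have hσn := hσ n
  have hτn := hτ n
  have hQ : 0 < Q := by
    by_contra hneg
    nlinarith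
  rw [dilationSeries, ← hs.sum_add_tsum_nat_add n, add_mul]
  refine (norm_add_le _ _).trans (add_le_add ?_ ?_)
  · have hterm : ∀ j ∈ Finset.range n, ‖(σ j : ℂ) * ((X / τ j) / (1 + X / τ j) ^ 2)‖
        ≤ ν ^ (n - 1 - j) * σ n := by
      intro j hj
      have hjn := Finset.mem_range.1 hj
      refine (norm_dilation_term_le' hσ hτ hX j).trans ?_
      rw [mul_comm]
      have h3 := le_pow_mul_of_le_mul_succ hν0 hν j (n - j)
      rw [Nat.add_sub_cancel' hjn.le] at h3
      have h4 : τ j / ‖X‖ ≤ ν ^ (n - 1 - j) := by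
        rw [div_le_iff₀ hX0]
        refine h3.trans ?_
        have h5 : ν ^ (n - j) ≤ ν ^ (n - 1 - j) :=
          pow_le_pow_of_le_one hν0 hν1.le (by omega)
        gcongr
      have h6 := hmono hjn.le
      have := (hσ j).le
      have : 0 ≤ ν ^ (n - 1 - j) := by positivity
      gcongr
    refine (norm_sum_le_of_le _ hterm).trans ?_
    rw [← Finset.sum_mul, Finset.sum_range_reflect (fun k => ν ^ k) n]
    gcongr
    rw [← tsum_geometric_of_lt_one hν0 hν1]
    exact (summable_geometric_of_lt_one hν0 hν1).sum_le_tsum _ fun j _ => by positivity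
  · refine (tsum_of_norm_bounded ((hasSum_geometric_of_lt_one hη0 hη1).mul_left (Q * σ n))
      fun k => ?_).trans (le_of_eq (by ring))
    refine (norm_dilation_term_le hσ hτ hX (k + n)).trans ?_
    calc ‖X‖ * (σ (k + n) / τ (k + n)) ≤ (Q * τ n) * (η ^ k * (σ n / τ n)) := by
          have := (div_pos (hσ (k + n)) (hτ (k + n))).le
          have := div_le_pow_mul_div hη0 hη n k
          gcongr
      _ = Q * σ n * η ^ k := by field_simp

end dilationSeries

section dilationTimes
variable {σ : ℕ → ℝ} {A c : ℝ}

theorem dilation_le_pow_mul (hc : 1 ≤ c) (hσc : ∀ j, σ (j + 1) ≤ c * σ j) (n i : ℕ) :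
    σ (n + i) ≤ c ^ i * σ n := by
  induction i with
  | zero => simp
  | succ i ih =>
    rw [← add_assoc, pow_succ', mul_assoc]
    exact (hσc _).trans (mul_le_mul_of_nonneg_left ih (by linarith))

theorem pow_mul_factorial_mul_exp_le (hσ : ∀ j, 0 < σ j) (hA : 1 < A) (hc : 1 ≤ c) (hcA : c ≤ A)
    (hσc : ∀ j, σ (j + 1) ≤ c * σ j) {b r : ℝ} (hb0 : 0 ≤ b) (hb1 : b ≤ 1) (hr : 0 ≤ r) {n : ℕ}
    (hrn : r ≤ A * (A ^ n / σ n)) (p : ℕ) :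
    ∃ j : ℕ, r ^ p * p.factorial * Real.exp (-(b * σ n))
      ≤ (A ^ 2 * Real.exp 1) ^ p * (A ^ j) ^ p * Real.exp (-(b * σ j)) := by
  have hσn := hσ n
  have hA0 : 0 < A := by linarith
  have hfac : (p.factorial : ℝ) ≤ (p : ℝ) ^ p := by exact_mod_cast Nat.factorial_le_pow p
  have hkey : r ^ p * p.factorial ≤ (A * A ^ n * (p / σ n)) ^ p := by
    calc r ^ p * p.factorial ≤ (A * (A ^ n / σ n)) ^ p * (p : ℝ) ^ p := by gcongr
      _ = _ := by rw [← mul_pow]; congr 1; ring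
  have he1 : 1 ≤ Real.exp 1 := Real.one_le_exp zero_le_one
  rcases le_or_gt (p : ℝ) (σ n) with h | h
  · refine ⟨n, mul_le_mul_of_nonneg_right (hkey.trans ?_) (Real.exp_pos _).le⟩
    rw [← mul_pow]
    refine pow_le_pow_left₀ (by positivity) ?_ p
    have h1 : (p : ℝ) / σ n ≤ 1 := (div_le_one hσn).2 h
    calc A * A ^ n * (p / σ n) ≤ A * A ^ n * 1 := by gcongr
      _ = (A * 1) * 1 * A ^ n := by ring
      _ ≤ (A * A) * Real.exp 1 * A ^ n := by gcongr
      _ = _ := by ring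
  · have h1 : 1 ≤ (p : ℝ) / σ n := (one_le_div hσn).2 h.le
    obtain ⟨i, hi1, hi2⟩ := exists_nat_pow_near h1 hA
    refine ⟨n + i, ?_⟩
    have hσj : σ (n + i) ≤ p := by
      refine (dilation_le_pow_mul hc hσc n i).trans ?_
      rw [← le_div_iff₀ hσn]
      exact (pow_le_pow_left₀ (by linarith) hcA i).trans hi1
    have hexp : Real.exp (-(b * σ n)) ≤ Real.exp 1 ^ p * Real.exp (-(b * σ (n + i))) := by
      rw [← Real.exp_nat_mul, ← Real.exp_add, Real.exp_le_exp]
      have : b * σ (n + i) ≤ 1 * p := mul_le_mul hb1 hσj (hσ _).le zero_le_one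
      nlinarith [mul_nonneg hb0 hσn.le]
    calc r ^ p * p.factorial * Real.exp (-(b * σ n))
        ≤ (A * A ^ n * (p / σ n)) ^ p * (Real.exp 1 ^ p * Real.exp (-(b * σ (n + i)))) := by
          gcongr
      _ ≤ (A * A ^ n * A ^ (i + 1)) ^ p * (Real.exp 1 ^ p * Real.exp (-(b * σ (n + i)))) := by
          gcongr
      _ = _ := by
          rw [← mul_assoc, ← mul_pow, ← mul_pow]
          congr 2
          ring

theorem dilationTime_le_succ (hσ : ∀ j, 0 < σ j) (hA : 0 < A) (hc : 0 < c)
    (hσc : ∀ j, σ (j + 1) ≤ c * σ j) (j : ℕ) :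
    A / c * (A ^ j / σ j) ≤ A ^ (j + 1) / σ (j + 1) := by
  have h1 := hσ j
  have h2 := hσ (j + 1)
  rw [div_mul_div_comm, pow_succ', div_le_div_iff₀ (by positivity) h2]
  exact mul_le_mul_of_nonneg_left (hσc j) (by positivity)

theorem dilationTime_succ_le (hσ : ∀ j, 0 < σ j) (hA : 0 < A) (hmono : Monotone σ) (j : ℕ) :
    A ^ (j + 1) / σ (j + 1) ≤ A * (A ^ j / σ j) := by
  have h1 := hσ j
  rw [← mul_div_assoc, pow_succ']
  exact div_le_div_of_nonneg_left (by positivity) h1 (hmono j.le_succ)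

theorem pow_mul_le_dilationTime (hσ : ∀ j, 0 < σ j) (hA : 0 < A) (hc : 0 < c)
    (hσc : ∀ j, σ (j + 1) ≤ c * σ j) (j : ℕ) :
    (A / c) ^ j * (σ 0)⁻¹ ≤ A ^ j / σ j := by
  induction j with
  | zero => simp
  | succ j ih =>
    refine le_trans ?_ (dilationTime_le_succ hσ hA hc hσc j)
    rw [pow_succ', mul_assoc]
    gcongr

theorem exists_dilationTime_near (hσ : ∀ j, 0 < σ j) (hmono : Monotone σ) (hc : 0 < c)
    (hcA : c < A) (hσc : ∀ j, σ (j + 1) ≤ c * σ j) (r : ℝ) :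
    ∃ n : ℕ, r ≤ A * (A ^ n / σ n) ∧ (n = 0 ∨ A ^ n / σ n ≤ r) := by
  classical
  have hA : 0 < A := hc.trans hcA
  have hex : ∃ n : ℕ, r ≤ A * (A ^ n / σ n) := by
    have h1 : 1 < A / c := (one_lt_div hc).2 hcA
    have h0 : 0 < σ 0 := hσ 0
    obtain ⟨n, hn⟩ := pow_unbounded_of_one_lt (r * σ 0 / A) h1
    refine ⟨n, ?_⟩
    calc r = A * (r * σ 0 / A * (σ 0)⁻¹) := by field_simp
      _ ≤ A * ((A / c) ^ n * (σ 0)⁻¹) := by gcongr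
      _ ≤ _ := by gcongr; exact pow_mul_le_dilationTime hσ hA hc hσc n
  refine ⟨Nat.find hex, Nat.find_spec hex, ?_⟩
  rcases hn : Nat.find hex with _ | m
  · exact Or.inl rfl
  · right
    have := Nat.find_min hex (m := m) (by omega)
    push Not at this
    exact (dilationTime_succ_le hσ hA hmono m).trans this.le

end dilationTimes

theorem re_exp_log_mul {γ α : ℝ} (hα : 0 < α) (hαγ : α * γ < 1) {z : ℂ}
    (hz : z ∈ sector γ) :
    Real.cos (α * γ * Real.pi / 2) * ‖z‖ ^ α ≤ (Complex.exp (α * Complex.log z)).re := by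
  have hz0 : 0 < ‖z‖ := norm_pos_iff.2 hz.1
  have hpi := Real.pi_pos
  have harg := hz.2
  have h1 : |α * Complex.arg z| ≤ α * γ * Real.pi / 2 := by
    rw [abs_mul, abs_of_pos hα]
    nlinarith
  rw [Complex.exp_re, Complex.re_ofReal_mul, Complex.im_ofReal_mul, Complex.log_re, Complex.log_im,
    Real.rpow_def_of_pos hz0, mul_comm α (Real.log _), mul_comm (Real.cos _)]
  refine mul_le_mul_of_nonneg_left ?_ (Real.exp_pos _).le
  rw [← Real.cos_abs (α * Complex.arg z)]
  refine Real.cos_le_cos_of_nonneg_of_le_pi (abs_nonneg _) ?_ h1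
  nlinarith

theorem norm_exp_log_mul {α : ℝ} {z : ℂ} (hz : z ≠ 0) :
    ‖Complex.exp (α * Complex.log z)‖ = ‖z‖ ^ α := by
  rw [Complex.norm_exp, Complex.re_ofReal_mul, Complex.log_re,
    Real.rpow_def_of_pos (norm_pos_iff.2 hz), mul_comm]

theorem cos_sector_pos {γ α : ℝ} (hγ : 0 < γ) (hα : 0 < α) (hαγ : α * γ < 1) :
    0 < Real.cos (α * γ * Real.pi / 2) := by
  have hpi := Real.pi_pos
  refine Real.cos_pos_of_mem_Ioo ⟨?_, ?_⟩
  · have : 0 < α * γ * Real.pi / 2 := by positivity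
    linarith
  · nlinarith

theorem exists_dilation_kernel {A c α γ : ℝ} (hA : 1 < A) (hc : 1 ≤ c) (hα : 0 < α)
    (hq : c < (A / c) ^ α) (hγ0 : 0 < γ) (hγ2 : γ < 2) (hαγ : α * γ < 1) :
    ∃ B b : ℝ, 0 < B ∧ 0 < b ∧ ∀ σ : ℕ → ℝ, (∀ j, 0 < σ j) → Monotone σ →
      (∀ j, σ (j + 1) ≤ c * σ j) → ∃ (e : ℂ → ℂ) (e₀ : ℝ → ℝ) (C : ℝ),
        DifferentiableOn ℂ e (sector γ) ∧ (∀ u : ℝ, 0 < u → e u = e₀ u) ∧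
        (∀ u, 0 < u → 0 < e₀ u) ∧
        (∀ n, ∀ u ∈ Icc (A ^ n / σ n) (2 * (A ^ n / σ n)), Real.exp (-(B * σ n)) ≤ e₀ u) ∧
        0 ≤ C ∧ ∀ p : ℕ, ∀ z ∈ sector γ, ∃ j : ℕ, ‖z‖ ^ p * (p.factorial * ‖e z‖)
          ≤ C * ((A ^ 2 * Real.exp 1) ^ p * (A ^ j) ^ p * Real.exp (-(b * σ j))) := by
  have hc0 : 0 < c := by linarith
  have hA0 : 0 < A := by linarith
  have hAc : c < A := by
    by_contra! h
    have : (A / c) ^ α ≤ 1 := Real.rpow_le_one (by positivity) ((div_le_one hc0).2 h) hα.le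
    linarith
  set q : ℝ := (A / c) ^ α with hqdef
  have hq0 : 0 < q := hc0.trans hq
  have hq1 : 1 < q := hc.trans_lt hq
  have hν1 : q⁻¹ < 1 := inv_lt_one_of_one_lt₀ hq1
  have hη1 : c / q < 1 := (div_lt_one hq0).2 hq
  have hη0 : 0 ≤ c / q := by positivity
  set δ := Real.cos (α * γ * Real.pi / 2) with hδdef
  have hδ : 0 < δ := cos_sector_pos hγ0 hα hαγ
  have hδ1 : δ ≤ 1 := Real.cos_le_one _
  have hAα : 0 < A ^ α := Real.rpow_pos_of_pos hA0 α
  set b := δ / (1 + A ^ α) ^ 2 with hbdef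
  have hb : 0 < b := by positivity
  have hb1 : b ≤ 1 := (div_le_self hδ.le (one_le_pow₀ (by linarith))).trans hδ1
  have hB1 : 0 < (1 - q⁻¹)⁻¹ := inv_pos.2 (by linarith)
  have hB2 : 0 < (1 - c / q)⁻¹ := inv_pos.2 (by linarith)
  refine ⟨(1 - q⁻¹)⁻¹ + 2 ^ α * (1 - c / q)⁻¹, b, by positivity, hb, fun σ hσ hmono hσc => ?_⟩
  set τ : ℕ → ℝ := fun j => (A ^ j / σ j) ^ α with hτdef
  have hT : ∀ j, 0 < A ^ j / σ j := fun j => div_pos (pow_pos hA0 j) (hσ j)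
  have hτ : ∀ j, 0 < τ j := fun j => Real.rpow_pos_of_pos (hT j) α
  have hτq : ∀ j, q * τ j ≤ τ (j + 1) := fun j => by
    rw [hqdef, hτdef]
    dsimp only
    rw [← Real.mul_rpow (by positivity) (hT j).le]
    exact Real.rpow_le_rpow (by have := hT j; positivity)
      (dilationTime_le_succ hσ hA0 hc0 hσc j) hα.le
  have hν : ∀ j, τ j ≤ q⁻¹ * τ (j + 1) := fun j => by
    rw [le_inv_mul_iff₀ hq0]; exact hτq j
  have hη : ∀ j, σ (j + 1) / τ (j + 1) ≤ c / q * (σ j / τ j) := fun j => by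
    have := hτ j
    rw [div_mul_div_comm]
    exact div_le_div₀ (mul_pos hc0 (hσ j)).le (hσc j) (by positivity) (hτq j)
  have hexpre : ∀ z ∈ sector γ, δ * ‖Complex.exp (α * Complex.log z)‖
      ≤ (Complex.exp (α * Complex.log z)).re := fun z hz => by
    rw [norm_exp_log_mul hz.1]
    exact re_exp_log_mul hα hαγ hz
  have hexpreal : ∀ u : ℝ, 0 < u → Complex.exp (α * Complex.log u) = ((u ^ α : ℝ) : ℂ) := by
    intro u hu
    rw [Real.rpow_def_of_pos hu, ← Complex.ofReal_log hu.le, Complex.ofReal_exp, Complex.ofReal_mul,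
      mul_comm]
  refine ⟨fun z => Complex.exp (-dilationSeries σ τ (Complex.exp (α * Complex.log z))),
    fun u => Real.exp (-(dilationSeries σ τ ((u ^ α : ℝ) : ℂ)).re), Real.exp (b * σ 0),
    ?_, ?_, fun u _ => Real.exp_pos _, ?_, (Real.exp_pos _).le, ?_⟩
  · refine DifferentiableOn.cexp (DifferentiableOn.neg ?_)
    refine (differentiableOn_dilationSeries hσ hτ hη0 hη1 hη).comp (t := {X : ℂ | 0 < X.re}) ?_ ?_
    · refine DifferentiableOn.cexp (DifferentiableOn.const_mul ?_ _)
      exact fun z hz => (Complex.differentiableAt_log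
        (sector_subset_slitPlane hγ2 hz)).differentiableWithinAt
    · intro z hz
      refine lt_of_lt_of_le ?_ (hexpre z hz)
      exact mul_pos hδ (norm_pos_iff.2 (Complex.exp_ne_zero _))
  · intro u hu
    dsimp only
    rw [hexpreal u hu, dilationSeries_ofReal]
    push_cast
    simp
  · intro n u hu
    have hu0 : 0 < u := (hT n).trans_le hu.1
    refine Real.exp_le_exp.2 (neg_le_neg ?_)
    refine (Complex.re_le_norm _).trans ?_
    have hn : ‖((u ^ α : ℝ) : ℂ)‖ = u ^ α := by
      rw [Complex.norm_real, Real.norm_of_nonneg (Real.rpow_nonneg hu0.le α)]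
    refine norm_dilationSeries_le hσ hτ hmono (inv_nonneg.2 hq0.le) hν1 hν hη0 hη1 hη ?_ ?_ ?_
    · rw [Complex.ofReal_re]; exact Real.rpow_nonneg hu0.le α
    · rw [hn]; exact Real.rpow_le_rpow (hT n).le hu.1 hα.le
    · rw [hn, hτdef]
      dsimp only
      rw [← Real.mul_rpow zero_le_two (hT n).le]
      exact Real.rpow_le_rpow hu0.le hu.2 hα.le
  · intro p z hz
    have hz0 : 0 < ‖z‖ := norm_pos_iff.2 hz.1
    obtain ⟨n, hn1, hn2⟩ := exists_dilationTime_near hσ hmono hc0 hAc hσc ‖z‖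
    obtain ⟨j, hj⟩ := pow_mul_factorial_mul_exp_le hσ hA hc hAc.le hσc hb.le hb1 hz0.le hn1 p
    refine ⟨j, ?_⟩
    have hre : b * σ n - b * σ 0
        ≤ (dilationSeries σ τ (Complex.exp (α * Complex.log z))).re := by
      have hle := le_re_dilationSeries hσ hτ hη0 hη1 hη hδ.le hδ1 (hexpre z hz) n
      rw [norm_exp_log_mul hz.1] at hle
      refine le_trans ?_ hle
      have hσn := hσ n
      have hR : 0 < ‖z‖ ^ α / τ n := div_pos (Real.rpow_pos_of_pos hz0 α) (hτ n)
      rcases hn2 with rfl | hn2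
      · rw [sub_self]; positivity
      · have hR1 : 1 ≤ ‖z‖ ^ α / τ n := by
          rw [one_le_div (hτ n)]
          exact Real.rpow_le_rpow (hT n).le hn2 hα.le
        have hR2 : ‖z‖ ^ α / τ n ≤ A ^ α := by
          rw [div_le_iff₀ (hτ n), hτdef]
          dsimp only
          rw [← Real.mul_rpow hA0.le (hT n).le]
          exact Real.rpow_le_rpow hz0.le hn1 hα.le
        have hbx : b ≤ δ * ((‖z‖ ^ α / τ n) / (1 + ‖z‖ ^ α / τ n) ^ 2) := by
          rw [hbdef, div_eq_mul_one_div]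
          gcongr
        have := mul_le_mul_of_nonneg_left hbx hσn.le
        have := mul_pos hb (hσ 0)
        linarith
    rw [Complex.norm_exp, Complex.neg_re]
    calc ‖z‖ ^ p * (p.factorial
          * Real.exp (-(dilationSeries σ τ (Complex.exp (α * Complex.log z))).re))
        ≤ ‖z‖ ^ p * (p.factorial * Real.exp (b * σ 0 + -(b * σ n))) := by
          gcongr
          linarith
      _ = Real.exp (b * σ 0) * (‖z‖ ^ p * p.factorial * Real.exp (-(b * σ n))) := by
          rw [Real.exp_add]; ring
      _ ≤ _ := by gcongr

theorem integrableOn_pow_mul_kernel {e : ℂ → ℂ} {γ : ℝ} (hγ : 0 < γ)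
    (he : ContinuousOn e (sector γ)) {e₀ : ℝ → ℝ} (he₀ : ∀ u : ℝ, 0 < u → e u = e₀ u) {p : ℕ}
    {C : ℝ} (hC : ∀ z ∈ sector γ, ‖z‖ ^ p * (1 + ‖z‖ ^ 2) * ‖e z‖ ≤ C) :
    IntegrableOn (fun u : ℝ => u ^ p * e₀ u) (Ioi 0) := by
  have h1 : (1 : ℂ) ∈ sector γ := by simpa using ofReal_mem_sector hγ one_pos
  have hψ : ∀ u : ℝ, 0 < u → ‖((u ^ p : ℝ) : ℂ)‖ ≤ 1 * u ^ p := fun u hu => by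
    rw [Complex.norm_real, Real.norm_of_nonneg (by positivity), one_mul]
  have hm : AEStronglyMeasurable (fun u : ℝ => ((u ^ p : ℝ) : ℂ)) (volume.restrict (Ioi 0)) := by
    fun_prop
  have h := (integrable_kernel_mul he hC hm hψ h1).re
  refine (integrable_congr ?_).1 h
  filter_upwards [ae_restrict_mem measurableSet_Ioi] with u hu
  rw [mul_one, he₀ u hu, ← Complex.ofReal_mul]
  exact mul_comm _ _

theorem pow_succ_mul_le_moment {e₀ : ℝ → ℝ} {p : ℕ} {T κ : ℝ} (hT : 0 < T) (hκ : 0 ≤ κ)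
    (hInt : IntegrableOn (fun u : ℝ => u ^ p * e₀ u) (Ioi 0)) (h0 : ∀ u, 0 < u → 0 < e₀ u)
    (h : ∀ u ∈ Icc T (2 * T), κ ≤ e₀ u) :
    T ^ (p + 1) * κ ≤ ∫ u in Ioi (0 : ℝ), u ^ p * e₀ u := by
  have hsub : Icc T (2 * T) ⊆ Ioi 0 := fun u hu => hT.trans_le hu.1
  calc T ^ (p + 1) * κ = ∫ _ in Icc T (2 * T), T ^ p * κ := by
        rw [setIntegral_const, smul_eq_mul, Real.volume_real_Icc_of_le (by linarith)]
        ring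
    _ ≤ ∫ u in Icc T (2 * T), u ^ p * e₀ u := by
        refine setIntegral_mono_on (integrableOn_const (by simp)) (hInt.mono_set hsub)
          measurableSet_Icc fun u hu => ?_
        have hu1 := hu.1
        have hu0 : 0 < u := hT.trans_le hu1
        have := h u hu
        gcongr
    _ ≤ _ := by
        refine setIntegral_mono_set hInt ?_ hsub.eventuallyLE
        filter_upwards [ae_restrict_mem measurableSet_Ioi] with u hu
        have hu0 : 0 < u := hu
        have := h0 u hu0
        exact mul_nonneg (pow_nonneg hu0.le p) this.le

theorem exists_borel_of_dilation {A c α γ γ' : ℝ} (hA : 1 < A) (hc : 1 ≤ c) (hα : 0 < α)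
    (hq : c < (A / c) ^ α) (hγ0 : 0 < γ) (hγγ' : γ < γ') (hγ' : γ' < 2) (hαγ : α * γ' < 1) :
    ∃ B b : ℝ, 0 < B ∧ 0 < b ∧ ∀ σ : ℕ → ℝ, (∀ j, 0 < σ j) → Monotone σ →
      (∀ j, σ (j + 1) ≤ c * σ j) → ∀ 𝓜 : Set (ℕ → ℝ), 𝓜.Nonempty → (∀ M ∈ 𝓜, ∀ p, 0 < M p) →
      (∀ M ∈ 𝓜, ∀ H : ℝ, 1 ≤ H → ∃ C : ℝ, ∀ j p : ℕ,
        H ^ p * ((A ^ j) ^ (p + 2) * Real.exp (-(b * σ j))) ≤ C * M p) →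
      ∀ (lam : ℕ → ℂ) (C D : ℝ), 0 < D → (∀ p, ∃ n : ℕ,
        ‖lam p‖ ≤ C * D ^ p * ((A ^ n) ^ p * Real.exp (-(B * σ n)))) →
      ∃ f : ℂ → ℂ, DifferentiableOn ℂ f (sector γ) ∧
        (∀ M ∈ 𝓜, ∃ C : ℝ, ∀ z ∈ sector γ, ∀ p : ℕ, ‖iteratedDeriv p f z‖ ≤ C * M p) ∧
        (∀ p : ℕ, Tendsto (iteratedDeriv p f) (nhdsWithin 0 (sector γ)) (nhds (lam p))) := by
  obtain ⟨B, b, hB, hb, hker⟩ :=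
    exists_dilation_kernel hA hc hα hq (hγ0.trans hγγ') hγ' hαγ
  refine ⟨B + 1, b, by linarith, hb, fun σ hσ hmono hσc 𝓜 hne hpos hdec lam C D hD hlam => ?_⟩
  obtain ⟨e, e₀, Ce, he, he₀, he₀pos, hlow, hCe, hup⟩ := hker σ hσ hmono hσc
  have hA0 : 0 < A := by linarith
  have hc0 : 0 < c := by linarith
  have hAc : 1 ≤ A / c := by
    by_contra! h
    have : (A / c) ^ α ≤ 1 := Real.rpow_le_one (by positivity) h.le hα.le
    linarith
  have hT : ∀ j, 0 < A ^ j / σ j := fun j => div_pos (pow_pos hA0 j) (hσ j)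
  set G : ℝ := A ^ 2 * Real.exp 1
  have hG1 : 1 ≤ G := one_le_mul_of_one_le_of_one_le (one_le_pow₀ hA.le)
    (Real.one_le_exp zero_le_one)
  have hdecay : ∀ M ∈ 𝓜, ∀ H : ℝ, 1 ≤ H → ∃ C : ℝ, ∀ (p : ℕ), ∀ z ∈ sector γ',
      H ^ p * (‖z‖ ^ p * (1 + ‖z‖ ^ 2) * (p.factorial * ‖e z‖)) ≤ C * M p := by
    intro M hM H hH
    obtain ⟨C₁, hC₁⟩ := hdec M hM (H * G) (one_le_mul_of_one_le_of_one_le hH hG1)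
    refine ⟨Ce * C₁ + Ce * G ^ 2 * C₁, fun p z hz => ?_⟩
    obtain ⟨j, hj⟩ := hup p z hz
    obtain ⟨k, hk⟩ := hup (p + 2) z hz
    have hfac : (p.factorial : ℝ) ≤ (p + 2).factorial := by
      exact_mod_cast Nat.factorial_le (by omega)
    have hAj : 1 ≤ A ^ j := one_le_pow₀ hA.le
    have h1 : H ^ p * (G ^ p * (A ^ j) ^ p * Real.exp (-(b * σ j))) ≤ C₁ * M p := by
      refine le_trans ?_ (hC₁ j p)
      rw [mul_pow H G p, mul_assoc (H ^ p), mul_assoc (G ^ p)]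
      have : (A ^ j) ^ p ≤ (A ^ j) ^ (p + 2) := pow_le_pow_right₀ hAj (by omega)
      gcongr
    have h2 : H ^ p * (G ^ (p + 2) * (A ^ k) ^ (p + 2) * Real.exp (-(b * σ k)))
        ≤ G ^ 2 * (C₁ * M p) := by
      refine le_trans (le_of_eq ?_) (mul_le_mul_of_nonneg_left (hC₁ k p) (by positivity))
      ring
    calc H ^ p * (‖z‖ ^ p * (1 + ‖z‖ ^ 2) * (p.factorial * ‖e z‖))
        = H ^ p * (‖z‖ ^ p * (p.factorial * ‖e z‖))
          + H ^ p * (‖z‖ ^ (p + 2) * (p.factorial * ‖e z‖)) := by ring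
      _ ≤ H ^ p * (‖z‖ ^ p * (p.factorial * ‖e z‖))
          + H ^ p * (‖z‖ ^ (p + 2) * ((p + 2).factorial * ‖e z‖)) := by gcongr
      _ ≤ H ^ p * (Ce * (G ^ p * (A ^ j) ^ p * Real.exp (-(b * σ j))))
          + H ^ p * (Ce * (G ^ (p + 2) * (A ^ k) ^ (p + 2) * Real.exp (-(b * σ k)))) := by
          gcongr
      _ = Ce * (H ^ p * (G ^ p * (A ^ j) ^ p * Real.exp (-(b * σ j))))
          + Ce * (H ^ p * (G ^ (p + 2) * (A ^ k) ^ (p + 2) * Real.exp (-(b * σ k)))) := by ring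
      _ ≤ Ce * (C₁ * M p) + Ce * (G ^ 2 * (C₁ * M p)) := by gcongr
      _ = _ := by ring
  have hInt : ∀ p : ℕ, IntegrableOn (fun u : ℝ => u ^ p * e₀ u) (Ioi 0) := by
    intro p
    obtain ⟨M, hM⟩ := hne
    obtain ⟨C', hC'⟩ := hdecay M hM 1 le_rfl
    refine integrableOn_pow_mul_kernel (hγ0.trans hγγ') he.continuousOn he₀ (C := C' * M p)
      fun z hz => le_trans ?_ (hC' p z hz)
    rw [one_pow, one_mul]
    have : (1 : ℝ) ≤ p.factorial := by exact_mod_cast p.factorial_pos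
    gcongr
    exact le_mul_of_one_le_left (norm_nonneg _) this
  have hmomlow : ∀ n p : ℕ, (A ^ n / σ n) ^ (p + 1) * Real.exp (-(B * σ n))
      ≤ ∫ u in Ioi (0 : ℝ), u ^ p * e₀ u := fun n p =>
    pow_succ_mul_le_moment (hT n) (Real.exp_pos _).le (hInt p) he₀pos (hlow n)
  have hTmono : ∀ n, (σ 0)⁻¹ ≤ A ^ n / σ n := fun n => by
    refine le_trans ?_ (pow_mul_le_dilationTime hσ hA0 hc0 hσc n)
    exact le_mul_of_one_le_left (inv_nonneg.2 (hσ 0).le) (one_le_pow₀ hAc)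
  refine exists_borel_of_kernel hγ0 hγγ' hγ' he he₀ 𝓜 hne hpos hdecay (A := |C| * σ 0) hD
    (fun p => lt_of_lt_of_le (by have := hT 0; positivity) (hmomlow 0 p)) fun p => ?_
  obtain ⟨n, hn⟩ := hlam p
  have hσn := hσ n
  have hσ0 := hσ 0
  have hexp : Real.exp (-σ n) * σ n ^ p ≤ p.factorial := by
    have := Real.pow_div_factorial_le_exp (σ n) hσn.le p
    rw [div_le_iff₀ (by positivity)] at this
    rw [Real.exp_neg, inv_mul_le_iff₀ (Real.exp_pos _)]
    exact this
  have hlower : (σ 0)⁻¹ * ((A ^ n) ^ p * Real.exp (-((B + 1) * σ n)))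
      ≤ p.factorial * ∫ u in Ioi (0 : ℝ), u ^ p * e₀ u := by
    calc (σ 0)⁻¹ * ((A ^ n) ^ p * Real.exp (-((B + 1) * σ n)))
        = (σ 0)⁻¹ * ((A ^ n / σ n) ^ p * (Real.exp (-σ n) * σ n ^ p) * Real.exp (-(B * σ n))) := by
          rw [show -((B + 1) * σ n) = -σ n + -(B * σ n) by ring, Real.exp_add, div_pow]
          field_simp
      _ ≤ (A ^ n / σ n) * ((A ^ n / σ n) ^ p * p.factorial * Real.exp (-(B * σ n))) := by
          have := hT n
          have := hTmono n
          gcongr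
      _ = p.factorial * ((A ^ n / σ n) ^ (p + 1) * Real.exp (-(B * σ n))) := by ring
      _ ≤ _ := by gcongr; exact hmomlow n p
  calc ‖lam p‖ ≤ C * D ^ p * ((A ^ n) ^ p * Real.exp (-((B + 1) * σ n))) := hn
    _ ≤ |C| * D ^ p * ((A ^ n) ^ p * Real.exp (-((B + 1) * σ n))) := by
        gcongr
        exact le_abs_self C
    _ = |C| * σ 0 * D ^ p * ((σ 0)⁻¹ * ((A ^ n) ^ p * Real.exp (-((B + 1) * σ n)))) := by
        field_simp
    _ ≤ _ := by gcongr

theorem IsWeightFunction.nonneg {ω : ℝ → ℝ} (hω : IsWeightFunction ω) {t : ℝ} (ht : 0 ≤ t) :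
    0 ≤ ω t :=
  hω.map_zero ▸ hω.monotoneOn self_mem_Ici ht ht

theorem bddAbove_phiStar {ω : ℝ → ℝ} (hω : IsWeightFunction ω) (h3 : Omega3 ω) (x : ℝ) :
    BddAbove ((fun y : ℝ => x * y - ω (Real.exp y)) '' Ici 0) := by
  have h := (h3.def (c := (|x| + 1)⁻¹) (by positivity)).and (eventually_gt_atTop 0)
  obtain ⟨t₀, ht₀⟩ := eventually_atTop.1 (Real.tendsto_exp_atTop.eventually h)
  refine ⟨|x| * |t₀|, ?_⟩
  rintro _ ⟨y, hy, rfl⟩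
  have hy0 : 0 ≤ y := hy
  have hω0 : 0 ≤ ω (Real.exp y) := hω.nonneg (Real.exp_pos y).le
  have hxy : x * y ≤ |x| * y := mul_le_mul_of_nonneg_right (le_abs_self x) hy0
  dsimp only
  rcases le_total t₀ y with hty | hty
  · have h1 := (ht₀ y hty).1
    rw [Real.log_exp, Real.norm_of_nonneg hy0, Real.norm_of_nonneg hω0,
      inv_mul_eq_div, le_div_iff₀ (by positivity)] at h1
    have : 0 ≤ |x| * |t₀| := by positivity
    nlinarith
  · have : |x| * y ≤ |x| * |t₀| :=
      mul_le_mul_of_nonneg_left (hty.trans (le_abs_self _)) (abs_nonneg _)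
    linarith

theorem pow_le_exp_mul_Wseq {ω : ℝ → ℝ} (hω : IsWeightFunction ω) (h3 : Omega3 ω) {l s : ℝ}
    (hl : 0 < l) (hs : 1 ≤ s) (p : ℕ) : s ^ p ≤ Real.exp (1 / l * ω s) * Wseq ω l p := by
  have hs0 : 0 < s := by linarith
  have h : l * p * Real.log s - ω (Real.exp (Real.log s)) ≤ phiStar ω (l * p) :=
    le_csSup (bddAbove_phiStar hω h3 _) ⟨Real.log s, Real.log_nonneg hs, rfl⟩
  rw [Real.exp_log hs0] at h
  rw [Wseq, ← Real.exp_add, ← Real.exp_log (pow_pos hs0 p), Real.log_pow, Real.exp_le_exp,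
    ← mul_add, one_div, le_inv_mul_iff₀ hl]
  linarith

theorem exists_Wseq_le_pow {ω : ℝ → ℝ} (hω : IsWeightFunction ω) {A t₀ N : ℝ} (hA : 1 < A)
    (ht₀ : 1 ≤ t₀) (hN : 0 < N) (p : ℕ) :
    ∃ n : ℕ, Wseq ω (1 / N) p ≤ Real.exp (1 + N * ω t₀)
      * (t₀ * A) ^ p * ((A ^ n) ^ p * Real.exp (-(N * ω (t₀ * A ^ n)))) := by
  have hA0 : 0 < A := by linarith
  have ht0 : 0 < t₀ := by linarith
  have hωt : 0 ≤ ω t₀ := hω.nonneg ht0.le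
  obtain ⟨_, ⟨y, -, rfl⟩, hy⟩ := exists_lt_of_lt_csSup
    (s := (fun y : ℝ => 1 / N * p * y - ω (Real.exp y)) '' Ici 0)
    ⟨_, mem_image_of_mem _ self_mem_Ici⟩ (sub_lt_self (phiStar ω (1 / N * p)) (one_div_pos.2 hN))
  have hW : Wseq ω (1 / N) p ≤ Real.exp 1 * (Real.exp y ^ p * Real.exp (-(N * ω (Real.exp y)))) := by
    rw [Wseq, ← Real.exp_nat_mul, ← Real.exp_add, ← Real.exp_add, Real.exp_le_exp, one_div_one_div]
    have := mul_lt_mul_of_pos_left hy hN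
    have h1 : N * (1 / N) = 1 := by field_simp
    have h2 : N * (phiStar ω (1 / N * p) - 1 / N) = N * phiStar ω (1 / N * p) - N * (1 / N) := by
      ring
    have h3 : N * (1 / N * p * y - ω (Real.exp y)) = N * (1 / N) * (p * y) - N * ω (Real.exp y) := by
      ring
    rw [h1] at h2 h3
    linarith
  have hexp : Real.exp (1 + N * ω t₀) = Real.exp 1 * Real.exp (N * ω t₀) := Real.exp_add _ _
  rcases le_or_gt t₀ (Real.exp y) with h | h
  · obtain ⟨n, hn1, hn2⟩ := exists_nat_pow_near ((one_le_div ht0).2 h) hA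
    rw [le_div_iff₀ ht0] at hn1
    rw [div_lt_iff₀ ht0] at hn2
    refine ⟨n, hW.trans ?_⟩
    have h1 : ω (t₀ * A ^ n) ≤ ω (Real.exp y) :=
      hω.monotoneOn (mem_Ici.2 (by positivity)) (mem_Ici.2 (Real.exp_pos y).le) (by linarith)
    have h2 : 1 ≤ Real.exp (N * ω t₀) := Real.one_le_exp (by positivity)
    have h3 : Real.exp y ≤ t₀ * A * A ^ n := by
      calc Real.exp y ≤ A ^ (n + 1) * t₀ := hn2.le
        _ = _ := by ring
    calc Real.exp 1 * (Real.exp y ^ p * Real.exp (-(N * ω (Real.exp y))))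
        ≤ Real.exp 1 * ((t₀ * A * A ^ n) ^ p * Real.exp (-(N * ω (t₀ * A ^ n)))) := by gcongr
      _ ≤ Real.exp 1 * Real.exp (N * ω t₀)
          * ((t₀ * A * A ^ n) ^ p * Real.exp (-(N * ω (t₀ * A ^ n)))) := by
          gcongr
          exact le_mul_of_one_le_right (Real.exp_pos 1).le h2
      _ = _ := by rw [hexp, mul_pow (t₀ * A)]; ring
  · refine ⟨0, hW.trans ?_⟩
    have h0 : 0 ≤ ω (Real.exp y) := hω.nonneg (Real.exp_pos y).le
    have h1 : Real.exp (-(N * ω (Real.exp y))) ≤ 1 :=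
      Real.exp_le_one_iff.2 (neg_nonpos.2 (by positivity))
    have h2 : Real.exp y ≤ t₀ * A := h.le.trans (le_mul_of_one_le_right ht0.le hA.le)
    calc Real.exp 1 * (Real.exp y ^ p * Real.exp (-(N * ω (Real.exp y))))
        ≤ Real.exp 1 * ((t₀ * A) ^ p * 1) := by gcongr
      _ = _ := by
          rw [hexp, pow_zero, one_pow, one_mul, mul_one, mul_one, Real.exp_neg]
          have := (Real.exp_pos (N * ω t₀)).ne'
          field_simp

theorem exists_slow_sequence {N n : ℕ → ℕ} (hN : Tendsto N atTop atTop) :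
    ∃ G : ℕ → ℕ, Monotone G ∧ (∀ j, G (j + 1) ≤ G j + 1) ∧ Tendsto G atTop atTop ∧
      ∀ p, G (n p) ≤ N p := by
  have hne : ∀ j, (range fun p => N p + (j - n p)).Nonempty := fun j => range_nonempty _
  have hle : ∀ j p, sInf (range fun p => N p + (j - n p)) ≤ N p + (j - n p) := fun j p =>
    Nat.sInf_le ⟨p, rfl⟩
  refine ⟨fun j => sInf (range fun p => N p + (j - n p)), fun j k hjk => ?_, fun j => ?_, ?_,
    fun p => ?_⟩
  · obtain ⟨p, hp⟩ := Nat.sInf_mem (hne k)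
    have := hle j p
    dsimp only at hp ⊢
    omega
  · obtain ⟨p, hp⟩ := Nat.sInf_mem (hne j)
    have := hle (j + 1) p
    dsimp only at hp ⊢
    omega
  · refine tendsto_atTop.2 fun m => ?_
    obtain ⟨P, hP⟩ := eventually_atTop.1 (tendsto_atTop.1 hN m)
    filter_upwards [eventually_ge_atTop (m + ∑ p ∈ Finset.range P, n p)] with j hj
    obtain ⟨p, hp⟩ := Nat.sInf_mem (hne j)
    rw [← hp]
    rcases le_or_gt P p with h | h
    · have := hP p h
      dsimp only
      omega
    · have := Finset.single_le_sum (f := n) (fun _ _ => Nat.zero_le _) (Finset.mem_range.2 h)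
      dsimp only
      omega
  · have := hle (n p) p
    dsimp only
    omega

theorem exists_tendsto_le_mul_exp (C : ℕ → ℝ) :
    ∃ (K : ℝ) (N : ℕ → ℕ), Tendsto N atTop atTop ∧ ∀ p : ℕ, C (N p) ≤ K * Real.exp p := by
  classical
  have hK : 0 < |C 0| + 1 := by positivity
  refine ⟨|C 0| + 1, fun p => Nat.findGreatest (fun N => C N ≤ (|C 0| + 1) * Real.exp p) p,
    tendsto_atTop.2 fun m => ?_, fun p => ?_⟩
  · have h : Tendsto (fun p : ℕ => (|C 0| + 1) * Real.exp p) atTop atTop :=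
      (Real.tendsto_exp_atTop.comp tendsto_natCast_atTop_atTop).const_mul_atTop hK
    filter_upwards [h.eventually_ge_atTop (C m), eventually_ge_atTop m] with p h1 h2
    exact Nat.le_findGreatest h2 h1
  · refine Nat.findGreatest_spec (P := fun N => C N ≤ (|C 0| + 1) * Real.exp p) (Nat.zero_le p) ?_
    have h1 : 1 ≤ Real.exp p := Real.one_le_exp p.cast_nonneg
    have h2 := le_abs_self (C 0)
    nlinarith

theorem exists_forall_le_of_eventually_le {x : ℕ → ℝ} {a : ℝ} (h : ∀ᶠ j in atTop, x j ≤ a) :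
    ∃ C, ∀ j, x j ≤ C := by
  obtain ⟨C, hC⟩ := (show IsBoundedUnder (· ≤ ·) atTop x from ⟨a, h⟩).bddAbove_range
  exact ⟨C, fun j => hC ⟨j, rfl⟩⟩

theorem exists_pow_mul_exp_le_Wseq {ω : ℝ → ℝ} (hω : IsWeightFunction ω) (h3 : Omega3 ω)
    {A c t₀ b : ℝ} (hA : 1 < A) (hc : 1 ≤ c) (ht₀ : 1 ≤ t₀)
    (hωc : ∀ t, t₀ ≤ t → ω (A * t) ≤ c * ω t) (hb : 0 < b) {κ : ℕ → ℝ}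
    (hκ : Tendsto κ atTop atTop) {l : ℝ} (hl : 0 < l) {H : ℝ} (hH : 0 ≤ H) :
    ∃ C : ℝ, ∀ j p : ℕ, H ^ p * ((A ^ j) ^ (p + 2) *
      Real.exp (-(b * (κ j * ω (t₀ * A ^ j))))) ≤ C * Wseq ω l p := by
  have hA0 : 0 < A := by linarith
  have ht0 : 0 < t₀ := by linarith
  obtain ⟨m, hm⟩ := pow_unbounded_of_one_lt H hA
  have hstep : ∀ i j : ℕ, ω (t₀ * A ^ (i + j)) ≤ c ^ i * ω (t₀ * A ^ j) := by
    intro i j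
    induction i with
    | zero => simp
    | succ i ih =>
      have h1 : t₀ ≤ t₀ * A ^ (i + j) := le_mul_of_one_le_right ht0.le (one_le_pow₀ hA.le)
      calc ω (t₀ * A ^ (i + 1 + j)) = ω (A * (t₀ * A ^ (i + j))) := by congr 1; ring
        _ ≤ c * ω (t₀ * A ^ (i + j)) := hωc _ h1
        _ ≤ c * (c ^ i * ω (t₀ * A ^ j)) := by gcongr
        _ = _ := by ring
  have hωs : ∀ j, ω (A ^ (m + j)) ≤ c ^ m * ω (t₀ * A ^ j) := fun j => by
    refine le_trans ?_ (hstep m j)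
    have h1 : 0 ≤ A ^ (m + j) := by positivity
    exact hω.monotoneOn h1 (mem_Ici.2 (by positivity)) (le_mul_of_one_le_left h1 ht₀)
  have htend : Tendsto (fun j : ℕ => t₀ * A ^ j) atTop atTop :=
    (tendsto_pow_atTop_atTop_of_one_lt hA).const_mul_atTop ht0
  have hev : ∀ᶠ j in atTop, (A ^ j) ^ 2 *
      Real.exp (1 / l * (c ^ m * ω (t₀ * A ^ j)) - b * (κ j * ω (t₀ * A ^ j))) ≤ 1 := by
    filter_upwards [htend.eventually (h3.def (c := 1 / 2) (by norm_num)),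
      hκ.eventually_ge_atTop ((1 / l * c ^ m + 1) / b)] with j h1 h2
    have hωj : 0 ≤ ω (t₀ * A ^ j) := hω.nonneg (by positivity)
    have hge : A ^ j ≤ t₀ * A ^ j := le_mul_of_one_le_left (by positivity) ht₀
    have hlog : Real.log (A ^ j) ≤ 1 / 2 * ω (t₀ * A ^ j) := by
      rw [Real.norm_of_nonneg hωj] at h1
      exact (Real.log_le_log (by positivity) hge).trans ((le_abs_self _).trans h1)
    rw [div_le_iff₀ hb] at h2
    have h4 := mul_le_mul_of_nonneg_right h2 hωj
    have h5 : (A ^ j) ^ 2 = Real.exp (2 * Real.log (A ^ j)) := by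
      rw [two_mul, Real.exp_add, Real.exp_log (by positivity), sq]
    rw [h5, ← Real.exp_add, Real.exp_le_one_iff]
    linarith
  obtain ⟨C, hC⟩ := exists_forall_le_of_eventually_le hev
  refine ⟨C, fun j p => ?_⟩
  have hs : 1 ≤ A ^ (m + j) := one_le_pow₀ hA.le
  have hW : 0 < Wseq ω l p := Real.exp_pos _
  calc H ^ p * ((A ^ j) ^ (p + 2) * Real.exp (-(b * (κ j * ω (t₀ * A ^ j)))))
      ≤ (A ^ m) ^ p * ((A ^ j) ^ (p + 2) * Real.exp (-(b * (κ j * ω (t₀ * A ^ j))))) := by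
        gcongr
    _ = (A ^ j) ^ 2 * Real.exp (-(b * (κ j * ω (t₀ * A ^ j)))) * (A ^ (m + j)) ^ p := by ring
    _ ≤ (A ^ j) ^ 2 * Real.exp (-(b * (κ j * ω (t₀ * A ^ j))))
        * (Real.exp (1 / l * (c ^ m * ω (t₀ * A ^ j))) * Wseq ω l p) := by
        gcongr
        refine (pow_le_exp_mul_Wseq hω h3 hl hs p).trans ?_
        gcongr
        exact hωs j
    _ = (A ^ j) ^ 2 * Real.exp (1 / l * (c ^ m * ω (t₀ * A ^ j))
        - b * (κ j * ω (t₀ * A ^ j))) * Wseq ω l p := by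
        rw [sub_eq_add_neg, Real.exp_add]; ring
    _ ≤ _ := by gcongr; exact hC j

theorem exists_Pcond_of_lt {ω : ℝ → ℝ} {γ : ℝ} (hγ0 : 0 < γ)
    (hγ : ENNReal.ofReal γ < gammaIndex ω - 1) : ∃ g, γ + 1 < g ∧ Pcond ω g := by
  have h : ENNReal.ofReal (γ + 1) < gammaIndex ω := by
    rw [ENNReal.ofReal_add hγ0.le zero_le_one, ENNReal.ofReal_one]
    exact lt_tsub_iff_right.1 hγ
  rw [gammaIndex] at h
  simp only [lt_iSup_iff] at h
  obtain ⟨g, hg, h⟩ := h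
  exact ⟨g, (ENNReal.ofReal_lt_ofReal_iff hg.1).1 h, hg.2⟩

theorem Pcond.exists_forall_le {ω : ℝ → ℝ} (hω : IsWeightFunction ω) {g : ℝ} (h : Pcond ω g) :
    ∃ K c t₀ : ℝ, 1 ≤ c ∧ c < K ∧ 1 ≤ t₀ ∧ 0 < ω t₀ ∧ ∀ t, t₀ ≤ t → ω (K ^ g * t) ≤ c * ω t := by
  obtain ⟨K, hK, c, hcK, hev⟩ := h
  obtain ⟨t₀, ht₀⟩ := eventually_atTop.1
    ((hev.and (hω.tendsto_atTop.eventually_gt_atTop 0)).and (eventually_ge_atTop 1))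
  refine ⟨K, max c 1, t₀, le_max_right _ _, max_lt hcK hK, (ht₀ t₀ le_rfl).2,
    (ht₀ t₀ le_rfl).1.2, fun t ht => ?_⟩
  obtain ⟨⟨h1, h2⟩, -⟩ := ht₀ t ht
  rw [div_le_iff₀ h2] at h1
  exact h1.trans (mul_le_mul_of_nonneg_right (le_max_left _ _) h2.le)

theorem exists_one_add_mul_lt {c K : ℝ} (hc : 0 < c) (hcK : c < K) :
    ∃ δ : ℝ, 0 < δ ∧ δ ≤ 1 ∧ (1 + δ) * c < K := by
  refine ⟨min 1 ((K - c) / (2 * c)), lt_min one_pos (div_pos (by linarith) (by linarith)),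
    min_le_left _ _, ?_⟩
  have h := mul_le_mul_of_nonneg_right (min_le_right 1 ((K - c) / (2 * c))) hc.le
  have h1 : (K - c) / (2 * c) * c = (K - c) / 2 := by field_simp
  linarith

theorem lt_div_rpow_of_lt {K c g : ℝ} (hc : 1 ≤ c) (hcK : c < K) (hg : 1 < g) :
    c < (K ^ g / c) ^ (1 / (g - 1)) := by
  have hc0 : 0 < c := by linarith
  have hK0 : 0 < K := by linarith
  have hg0 : 0 < g - 1 := by linarith
  have hKK : K = (K ^ (g - 1)) ^ (1 / (g - 1)) := by
    rw [← Real.rpow_mul hK0.le, mul_one_div_cancel hg0.ne', Real.rpow_one]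
  refine hcK.trans_le (hKK.le.trans ?_)
  refine Real.rpow_le_rpow (by positivity) ?_ (by positivity)
  rw [Real.rpow_sub_one hK0.ne']
  have := Real.rpow_pos_of_pos hK0 g
  gcongr

/-- Beurling case, weight functions: surjectivity of the Borel map
on the Beurling class `A_{(ω)}(S_γ)` for `0 < γ < min(2, γ(ω) − 1)`. -/
theorem beurling_borel_surjective_weight_function
    (ω : ℝ → ℝ) (hω : InW0 ω) (hγω : 1 < gammaIndex ω)
    (γ : ℝ) (hγ0 : 0 < γ)
    (hγ : ENNReal.ofReal γ < min 2 (gammaIndex ω - 1))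
    (lam : ℕ → ℂ)
    (hlam : ∀ l : ℝ, 0 < l → ∃ A : ℝ,
      ∀ p : ℕ, ‖lam p‖ ≤ A * Real.exp ((1 / l) * phiStar ω (l * (p : ℝ)))) :
    ∃ f : ℂ → ℂ, DifferentiableOn ℂ f (sector γ) ∧
      (∀ l : ℝ, 0 < l → ∃ C : ℝ, ∀ z ∈ sector γ, ∀ p : ℕ,
        ‖iteratedDeriv p f z‖ ≤ C * Real.exp ((1 / l) * phiStar ω (l * (p : ℝ)))) ∧
      (∀ p : ℕ, Filter.Tendsto (iteratedDeriv p f)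
        (nhdsWithin 0 (sector γ)) (nhds (lam p))) := by
  obtain ⟨hw, -, h3, -⟩ := hω
  obtain ⟨hγ2, hγg⟩ := lt_min_iff.1 hγ
  replace hγ2 : γ < 2 := by simpa using hγ2
  obtain ⟨g, hg, hP⟩ := exists_Pcond_of_lt hγ0 hγg
  obtain ⟨K, c, t₀, hc, hcK, ht₀, hωt₀, hωc⟩ := hP.exists_forall_le hw
  obtain ⟨δ, hδ0, hδ1, hδK⟩ := exists_one_add_mul_lt (by linarith) hcK
  obtain ⟨γ', hγγ', hγ'⟩ := exists_between (lt_min hγ2 (lt_tsub_iff_right.2 hg))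
  obtain ⟨hγ'2, hγ'g⟩ := lt_min_iff.1 hγ'
  have hA : 1 < K ^ g := Real.one_lt_rpow (by linarith) (by linarith)
  have hg1 : 0 < g - 1 := by linarith
  have hc' : 1 ≤ (1 + δ) * c := one_le_mul_of_one_le_of_one_le (by linarith) hc
  obtain ⟨B, b, hB, hb, hmain⟩ := exists_borel_of_dilation hA hc' (one_div_pos.2 hg1)
    (lt_div_rpow_of_lt hc' hδK (by linarith)) hγ0 hγγ' hγ'2
    (by rw [one_div_mul_eq_div]; exact (div_lt_one hg1).2 hγ'g)
  set A := K ^ g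
  have hA0 : 0 < A := by linarith
  have ht0 : 0 < t₀ := by linarith
  have hlamN : ∀ N : ℕ, ∃ C : ℝ, ∀ p : ℕ, ∃ n : ℕ, ‖lam p‖ ≤ C * (t₀ * A) ^ p *
      ((A ^ n) ^ p * Real.exp (-(B * (N + 1) * ω (t₀ * A ^ n)))) := by
    intro N
    have hN : 0 < B * (N + 1) := by positivity
    obtain ⟨C, hC⟩ := hlam (1 / (B * (N + 1))) (one_div_pos.2 hN)
    refine ⟨|C| * Real.exp (1 + B * (N + 1) * ω t₀), fun p => ?_⟩
    obtain ⟨n, hn⟩ := exists_Wseq_le_pow hw hA ht₀ hN p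
    refine ⟨n, (hC p).trans ?_⟩
    calc C * Wseq ω (1 / (B * (N + 1))) p ≤ |C| * Wseq ω (1 / (B * (N + 1))) p :=
          mul_le_mul_of_nonneg_right (le_abs_self C) (Real.exp_pos _).le
      _ ≤ |C| * _ := mul_le_mul_of_nonneg_left hn (abs_nonneg C)
      _ = _ := by ring
  choose C n hn using hlamN
  obtain ⟨C₀, N, hN, hCN⟩ := exists_tendsto_le_mul_exp C
  obtain ⟨G, hGmono, hGsucc, hGtend, hGN⟩ := exists_slow_sequence (n := fun p => n (N p) p) hN
  have hωpos : ∀ j : ℕ, 0 < ω (t₀ * A ^ j) := fun j =>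
    hωt₀.trans_le (hw.monotoneOn ht0.le (mem_Ici.2 (by positivity))
      (le_mul_of_one_le_right ht0.le (one_le_pow₀ hA.le)))
  have hκ : Tendsto (fun j => 1 + δ * (G j : ℝ)) atTop atTop :=
    tendsto_const_nhds.add_atTop
      ((tendsto_natCast_atTop_atTop.comp hGtend).const_mul_atTop hδ0)
  obtain ⟨f, hf, hfM, hflim⟩ := hmain (fun j => (1 + δ * G j) * ω (t₀ * A ^ j))
    (fun j => mul_pos (by positivity) (hωpos j)) (fun i j hij => by
      have h1 : (G i : ℝ) ≤ G j := by exact_mod_cast hGmono hij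
      have h2 : ω (t₀ * A ^ i) ≤ ω (t₀ * A ^ j) :=
        hw.monotoneOn (mem_Ici.2 (by positivity)) (mem_Ici.2 (by positivity))
          (mul_le_mul_of_nonneg_left (pow_le_pow_right₀ hA.le hij) ht0.le)
      have h3 := (hωpos i).le
      dsimp only
      gcongr) (fun j => by
      have h1 : (G (j + 1) : ℝ) ≤ G j + 1 := by exact_mod_cast hGsucc j
      have h2 : ω (t₀ * A ^ (j + 1)) ≤ c * ω (t₀ * A ^ j) := by
        rw [show t₀ * A ^ (j + 1) = A * (t₀ * A ^ j) by ring]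
        exact hωc _ (le_mul_of_one_le_right ht0.le (one_le_pow₀ hA.le))
      have h3 : 1 + δ * (G (j + 1) : ℝ) ≤ (1 + δ) * (1 + δ * G j) := by
        have h4 : 0 ≤ (G j : ℝ) := Nat.cast_nonneg _
        nlinarith [mul_nonneg (mul_nonneg hδ0.le hδ0.le) h4]
      calc (1 + δ * G (j + 1)) * ω (t₀ * A ^ (j + 1))
          ≤ ((1 + δ) * (1 + δ * G j)) * (c * ω (t₀ * A ^ j)) :=
            mul_le_mul h3 h2 (hωpos _).le (by positivity)
        _ = _ := by ring)
    {M | ∃ l : ℝ, 0 < l ∧ M = Wseq ω l} ⟨_, 1, one_pos, rfl⟩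
    (by rintro _ ⟨l, -, rfl⟩ p; exact Real.exp_pos _)
    (by
      rintro _ ⟨l, hl, rfl⟩ H hH
      exact exists_pow_mul_exp_le_Wseq hw h3 hA hc ht₀ hωc hb hκ hl (zero_le_one.trans hH))
    lam C₀ (Real.exp 1 * (t₀ * A)) (by positivity) (fun p => by
      refine ⟨n (N p) p, (hn (N p) p).trans ?_⟩
      have h1 : (G (n (N p) p) : ℝ) ≤ N p := by exact_mod_cast hGN p
      have h2 : 1 + δ * (G (n (N p) p) : ℝ) ≤ N p + 1 := by
        have : δ * (G (n (N p) p) : ℝ) ≤ 1 * N p := by gcongr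
        linarith
      have h3 := (hωpos (n (N p) p)).le
      have h4 : 0 ≤ C₀ * Real.exp p := by
        by_contra! hneg
        have h5 := (norm_nonneg _).trans (hn (N p) p)
        have h6 : C (N p) < 0 := (hCN p).trans_lt hneg
        have h7 : 0 < (t₀ * A) ^ p * ((A ^ n (N p) p) ^ p *
          Real.exp (-(B * (N p + 1) * ω (t₀ * A ^ n (N p) p)))) := by positivity
        rw [mul_assoc] at h5
        exact absurd h5 (not_le.2 (mul_neg_of_neg_of_pos h6 h7))
      calc C (N p) * (t₀ * A) ^ p * ((A ^ n (N p) p) ^ p *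
            Real.exp (-(B * (N p + 1) * ω (t₀ * A ^ n (N p) p))))
          ≤ C₀ * Real.exp p * (t₀ * A) ^ p * ((A ^ n (N p) p) ^ p *
            Real.exp (-(B * ((1 + δ * G (n (N p) p)) * ω (t₀ * A ^ n (N p) p))))) := by
            rw [mul_assoc B]
            have := hCN p
            gcongr
        _ = _ := by rw [← Real.exp_one_pow]; ring)
  exact ⟨f, hf, fun l hl => hfM _ ⟨l, hl, rfl⟩, hflim⟩
end

section
/- Let ω be a weight function with (ω_5) and γ((ω⋆)^ι) > 1. For a > 0 define F_a(w) := exp((1/π) ∫_{−∞}^{+∞} (−a ω⋆(|t|)/(1+t²)) · (itw − 1)/(it − w) dt) for w in the right half-plane H₁ := {ξ ∈ ℂ : Re ξ > 0}. Then F_a is holomorphic on H₁, and there exist constants A, B ≥ 1 depending only on ω such that for all a > 0 and all ξ ∈ H₁: B^{−a} exp(−2a ω⋆(B^{−1} Re ξ)) ≤ |F_a(ξ)| ≤ exp(−(a/2) ω⋆(A|ξ|)). -/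
open Filter MeasureTheory Set Asymptotics

theorem intervalIntegrable_of_antitoneOn_Ioi {u : ℝ → ℝ} (hu : AntitoneOn u (Ioi 0)) {a b : ℝ}
    (ha : 0 < a) (hb : 0 < b) : IntervalIntegrable u volume a b :=
  (hu.mono fun _ hx => (lt_min ha hb).trans_le hx.1).intervalIntegrable

/-- A geometric growth bound at the origin controls the mass of an antitone function near `0`. -/
theorem intervalIntegral_le_of_comp_mul_le {u : ℝ → ℝ} (hu : AntitoneOn u (Ioi 0))
    (hu0 : ∀ s, 0 < s → 0 ≤ u s) {q c s₀ : ℝ} (hq : 0 < q) (hq1 : q < 1)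
    (hqc : q * c < 1) (hgrowth : ∀ s, 0 < s → s ≤ s₀ → u (q * s) ≤ c * u s)
    {δ ε : ℝ} (hδ : 0 < δ) (hδs : δ ≤ s₀) (hε : 0 < ε) (hεδ : ε ≤ δ) :
    ∫ s in ε..δ, u s ≤ c / (1 - q * c) * δ * u δ := by
  have hqε : 0 < q * ε := mul_pos hq hε
  have hqδ : 0 < q * δ := mul_pos hq hδ
  have int : ∀ {a b : ℝ}, 0 < a → 0 < b → IntervalIntegrable u volume a b :=
    fun ha hb => intervalIntegrable_of_antitoneOn_Ioi hu ha hb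
  have hscale : ∫ s in q * ε..q * δ, u s ≤ q * (c * ∫ s in ε..δ, u s) := by
    rw [← intervalIntegral.mul_integral_comp_mul_left, ← intervalIntegral.integral_const_mul c]
    refine mul_le_mul_of_nonneg_left (intervalIntegral.integral_mono_on hεδ ?_
      ((int hε hδ).const_mul c) fun s hs =>
        hgrowth s (hε.trans_le hs.1) (hs.2.trans hδs)) hq.le
    refine AntitoneOn.intervalIntegrable fun s hs t ht hst => ?_
    have pos : ∀ {r}, r ∈ uIcc ε δ → 0 < r := fun hr => (lt_min hε hδ).trans_le hr.1
    exact hu (mul_pos hq (pos hs)) (mul_pos hq (pos ht)) (mul_le_mul_of_nonneg_left hst hq.le)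
  have htop : ∫ s in q * δ..δ, u s ≤ c * δ * u δ := by
    have hle : q * δ ≤ δ := mul_le_of_le_one_left hδ.le hq1.le
    calc ∫ s in q * δ..δ, u s ≤ ∫ _ in q * δ..δ, u (q * δ) :=
          intervalIntegral.integral_mono_on hle (int hqδ hδ) intervalIntegrable_const
            fun s hs => hu hqδ (hqδ.trans_le hs.1) hs.1
      _ = (δ - q * δ) * u (q * δ) := by simp
      _ ≤ δ * u (q * δ) := mul_le_mul_of_nonneg_right (by linarith) (hu0 _ hqδ)
      _ ≤ δ * (c * u δ) := mul_le_mul_of_nonneg_left (hgrowth δ hδ hδs) hδ.le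
      _ = c * δ * u δ := by ring
  have hbottom : 0 ≤ ∫ s in q * ε..ε, u s :=
    intervalIntegral.integral_nonneg (mul_le_of_le_one_left hε.le hq1.le)
      fun s hs => hu0 s (hqε.trans_le hs.1)
  have h1 := intervalIntegral.integral_add_adjacent_intervals (int hqε hqδ) (int hqδ hδ)
  have h2 := intervalIntegral.integral_add_adjacent_intervals (int hqε hε) (int hε hδ)
  rw [div_mul_eq_mul_div, div_mul_eq_mul_div, le_div_iff₀ (by linarith)]
  nlinarith

theorem integrableOn_Ioc_of_comp_mul_le {u : ℝ → ℝ} (hu : AntitoneOn u (Ioi 0))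
    (hu0 : ∀ s, 0 < s → 0 ≤ u s) {q c s₀ : ℝ} (hq : 0 < q) (hq1 : q < 1) (hs₀ : 0 < s₀)
    (hqc : q * c < 1) (hgrowth : ∀ s, 0 < s → s ≤ s₀ → u (q * s) ≤ c * u s) (δ : ℝ) :
    IntegrableOn u (Ioc 0 δ) := by
  have hnear : IntegrableOn u (Ioc 0 s₀) := by
    have ha : Tendsto (fun n : ℕ => s₀ / (n + 1 : ℝ)) atTop (nhds 0) := by
      simpa [div_eq_mul_inv] using (tendsto_one_div_add_atTop_nhds_zero_nat (𝕜 := ℝ)).const_mul s₀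
    have ha0 : ∀ n : ℕ, 0 < s₀ / (n + 1 : ℝ) := fun n => by positivity
    have ha1 : ∀ n : ℕ, s₀ / (n + 1 : ℝ) ≤ s₀ := fun n =>
      div_le_self hs₀.le (by linarith [n.cast_nonneg (α := ℝ)])
    refine integrableOn_Ioc_of_intervalIntegral_norm_bounded_left
      (I := c / (1 - q * c) * s₀ * u s₀) (fun n => ?_) ha (Eventually.of_forall fun n => ?_)
    · exact (intervalIntegrable_iff_integrableOn_Ioc_of_le (ha1 n)).1
        (intervalIntegrable_of_antitoneOn_Ioi hu (ha0 n) hs₀)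
    · rw [setIntegral_congr_fun (g := u) measurableSet_Ioc fun s hs =>
        Real.norm_of_nonneg (hu0 s ((ha0 n).trans hs.1)),
        ← intervalIntegral.integral_of_le (ha1 n)]
      exact intervalIntegral_le_of_comp_mul_le hu hu0 hq hq1 hqc hgrowth hs₀ le_rfl (ha0 n) (ha1 n)
  rcases le_or_gt δ s₀ with h | h
  · exact hnear.mono_set (Ioc_subset_Ioc_right h)
  · rw [← Ioc_union_Ioc_eq_Ioc hs₀.le h.le]
    exact hnear.union ((intervalIntegrable_iff_integrableOn_Ioc_of_le h.le).1
      (intervalIntegrable_of_antitoneOn_Ioi hu hs₀ (hs₀.trans h)))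

theorem exists_setIntegral_Ioc_le_of_comp_mul_le {u : ℝ → ℝ} (hu : AntitoneOn u (Ioi 0))
    (hu0 : ∀ s, 0 < s → 0 ≤ u s) {q c s₀ : ℝ} (hq : 0 < q) (hq1 : q < 1) (hs₀ : 0 < s₀)
    (hqc : q * c < 1) (hgrowth : ∀ s, 0 < s → s ≤ s₀ → u (q * s) ≤ c * u s) :
    ∃ C : ℝ, 0 < C ∧ ∀ δ, 0 < δ → ∫ s in Ioc 0 δ, u s ≤ C * δ * (u δ + 1) := by
  have int := integrableOn_Ioc_of_comp_mul_le hu hu0 hq hq1 hs₀ hqc hgrowth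
  have hnear : ∀ δ, 0 < δ → δ ≤ s₀ → ∫ s in Ioc 0 δ, u s ≤ c / (1 - q * c) * δ * u δ := by
    intro δ hδ hδs
    rw [← intervalIntegral.integral_of_le hδ.le]
    have hcont : ContinuousOn (fun x => ∫ t in x..δ, u t) (uIcc 0 δ) := by
      apply intervalIntegral.continuousOn_primitive_interval_left
      rw [uIcc_of_le hδ.le, integrableOn_Icc_iff_integrableOn_Ioc]
      exact int δ
    have h0 := (hcont 0 left_mem_uIcc).mono (s := Ioc 0 δ)
      (by rw [uIcc_of_le hδ.le]; exact Ioc_subset_Icc_self)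
    have : (nhdsWithin (0 : ℝ) (Ioc 0 δ)).NeBot := by
      rw [nhdsWithin_Ioc_eq_nhdsGT hδ]; infer_instance
    exact le_of_tendsto h0 (eventually_nhdsWithin_of_forall fun ε hε =>
      intervalIntegral_le_of_comp_mul_le hu hu0 hq hq1 hqc hgrowth hδ hδs hε.1 hε.2)
  set D := c / (1 - q * c)
  have hus := hu0 s₀ hs₀
  refine ⟨|D| * (1 + u s₀) + u s₀ + 1, by positivity, fun δ hδ => ?_⟩
  have hδu := hu0 δ hδ
  rcases le_or_gt δ s₀ with h | h
  · calc _ ≤ D * δ * u δ := hnear δ hδ h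
      _ = D * (δ * u δ) := by ring
      _ ≤ (|D| * (1 + u s₀) + u s₀ + 1) * (δ * u δ) :=
        mul_le_mul_of_nonneg_right (by nlinarith [le_abs_self D, abs_nonneg D]) (by positivity)
      _ ≤ (|D| * (1 + u s₀) + u s₀ + 1) * (δ * (u δ + 1)) :=
        mul_le_mul_of_nonneg_left (by nlinarith) (by positivity)
      _ = _ := by ring
  · have hsplit : ∫ s in Ioc 0 δ, u s = (∫ s in Ioc 0 s₀, u s) + ∫ s in s₀..δ, u s := by
      rw [intervalIntegral.integral_of_le h.le, ← Ioc_union_Ioc_eq_Ioc hs₀.le h.le,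
        setIntegral_union (Ioc_disjoint_Ioc_of_le le_rfl) measurableSet_Ioc (int s₀)
          ((int δ).mono_set (Ioc_subset_Ioc_left hs₀.le))]
    have hfar : ∫ s in s₀..δ, u s ≤ (δ - s₀) * u s₀ :=
      calc _ ≤ ∫ _ in s₀..δ, u s₀ :=
            intervalIntegral.integral_mono_on h.le (intervalIntegrable_of_antitoneOn_Ioi hu hs₀ hδ)
              intervalIntegrable_const fun s hs => hu hs₀ (hs₀.trans_le hs.1) hs.1
        _ = _ := by simp
    have hD : D * s₀ * u s₀ ≤ |D| * δ * u s₀ :=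
      mul_le_mul_of_nonneg_right (mul_le_mul (le_abs_self D) h.le hs₀.le (abs_nonneg D)) hus
    have hpos : 0 ≤ (|D| * (1 + u s₀) + u s₀ + 1) * δ * u δ := by positivity
    have hpos' : 0 ≤ |D| * δ := by positivity
    rw [hsplit]
    nlinarith [hnear s₀ hs₀ le_rfl, mul_pos hs₀ hδ, mul_nonneg hs₀.le hus]

theorem upperConj_bddAbove {ω : ℝ → ℝ} (hω : IsWeightFunction ω) (h5 : Omega5 ω) {s : ℝ}
    (hs : 0 < s) : BddAbove ((fun t : ℝ => ω t - s * t) '' Ici 0) := by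
  obtain ⟨T, hT⟩ := eventually_atTop.1 (h5.def hs)
  refine ⟨max (ω (max T 0)) 0, ?_⟩
  rintro _ ⟨t, ht, rfl⟩
  have ht : 0 ≤ t := ht
  rcases le_total t (max T 0) with h | h
  · refine le_max_of_le_left ?_
    have := hω.monotoneOn ht (le_max_right T 0 : max T 0 ∈ Ici 0) h
    dsimp only
    nlinarith
  · refine le_max_of_le_right ?_
    have := (le_abs_self _).trans (hT t ((le_max_left _ _).trans h))
    rw [Real.norm_of_nonneg ht] at this
    dsimp only
    linarith

theorem le_upperConj {ω : ℝ → ℝ} (hω : IsWeightFunction ω) (h5 : Omega5 ω) {s t : ℝ}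
    (hs : 0 < s) (ht : 0 ≤ t) : ω t - s * t ≤ upperConj ω s :=
  le_csSup (upperConj_bddAbove hω h5 hs) ⟨t, ht, rfl⟩

theorem upperConj_nonneg {ω : ℝ → ℝ} (hω : IsWeightFunction ω) (h5 : Omega5 ω) {s : ℝ}
    (hs : 0 < s) : 0 ≤ upperConj ω s := by
  simpa [hω.map_zero] using le_upperConj hω h5 hs le_rfl

theorem upperConj_antitoneOn {ω : ℝ → ℝ} (hω : IsWeightFunction ω) (h5 : Omega5 ω) :
    AntitoneOn (upperConj ω) (Ioi 0) := by
  intro s hs t _ hst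
  refine csSup_le ⟨_, 0, self_mem_Ici, rfl⟩ ?_
  rintro _ ⟨r, hr, rfl⟩
  have hr : 0 ≤ r := hr
  have := le_upperConj hω h5 hs hr
  dsimp only
  nlinarith

theorem exists_upperConj_pos {ω : ℝ → ℝ} (hω : IsWeightFunction ω) (h5 : Omega5 ω) :
    ∃ s₀, 0 < s₀ ∧ ∀ s, 0 < s → s ≤ s₀ → 0 < upperConj ω s := by
  obtain ⟨T, hT, hT0⟩ := ((hω.tendsto_atTop.eventually_ge_atTop 2).and (eventually_gt_atTop 0)).exists
  refine ⟨1 / T, by positivity, fun s hs hsT => ?_⟩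
  have h := le_upperConj hω h5 hs hT0.le
  rw [le_div_iff₀ hT0] at hsT
  linarith

/-- A growth index of `(ω⋆)^ι` above `1` gives a contraction estimate for `ω⋆` near `0`. -/
theorem exists_upperConj_comp_mul_le {ω : ℝ → ℝ} (hω : IsWeightFunction ω) (h5 : Omega5 ω)
    (hγι : 1 < gammaIndex (upperConjIota ω)) :
    ∃ q c s₀ : ℝ, 0 < q ∧ q < 1 ∧ 0 < s₀ ∧ q * c < 1 ∧
      ∀ s, 0 < s → s ≤ s₀ → upperConj ω (q * s) ≤ c * upperConj ω s := by
  obtain ⟨γ, hγ⟩ := lt_iSup_iff.1 hγι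
  obtain ⟨⟨-, K, hK, c, hc, hev⟩, hγ1⟩ := lt_iSup_iff.1 hγ
  rw [ENNReal.one_lt_ofReal] at hγ1
  obtain ⟨T, hT⟩ := eventually_atTop.1 hev
  obtain ⟨s₁, hs₁, hpos⟩ := exists_upperConj_pos hω h5
  have hK0 : 0 < K := one_pos.trans hK
  have hKγ : K < K ^ γ := by
    simpa using Real.rpow_lt_rpow_of_exponent_lt hK hγ1
  have hKγ0 : 0 < K ^ γ := hK0.trans hKγ
  refine ⟨(K ^ γ)⁻¹, c, min s₁ (1 / max T 1), by positivity,
    inv_lt_one_of_one_lt₀ (hK.trans hKγ), lt_min hs₁ (by positivity), ?_, fun s hs hs₀ => ?_⟩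
  · rw [inv_mul_lt_one₀ hKγ0]
    exact hc.trans hKγ
  · have hTs : T ≤ 1 / s := by
      have := (le_div_iff₀ (by positivity)).1 (hs₀.trans (min_le_right _ _))
      rw [le_div_iff₀ hs]
      nlinarith [le_max_left T 1]
    have h := hT _ hTs
    have hne : K ^ γ * (1 / s) ≠ 0 := by positivity
    have heq : 1 / (K ^ γ * (1 / s)) = (K ^ γ)⁻¹ * s := by field_simp
    rw [upperConjIota, if_neg hne, upperConjIota, if_neg (by positivity), heq, one_div_one_div,
      div_le_iff₀ (hpos s hs (hs₀.trans (min_le_left _ _)))] at h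
    exact h

theorem integrable_indicator_add_comp_neg {u : ℝ → ℝ} {δ : ℝ} (hint : IntegrableOn u (Ioc 0 δ)) :
    Integrable (fun t => (Ioc 0 δ).indicator u t + (Ioc 0 δ).indicator u (-t)) :=
  (hint.integrable_indicator measurableSet_Ioc).add
    (hint.integrable_indicator measurableSet_Ioc).comp_neg

theorem integral_indicator_add_comp_neg {u : ℝ → ℝ} {δ : ℝ} (hint : IntegrableOn u (Ioc 0 δ)) :
    ∫ t, ((Ioc 0 δ).indicator u t + (Ioc 0 δ).indicator u (-t)) = 2 * ∫ s in Ioc 0 δ, u s := by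
  have h := hint.integrable_indicator measurableSet_Ioc
  rw [integral_add h h.comp_neg, integral_neg_eq_self, integral_indicator measurableSet_Ioc]
  ring

theorem comp_abs_le_indicator_add {u : ℝ → ℝ} (hu0 : ∀ s, 0 < s → 0 ≤ u s) {δ t : ℝ}
    (ht : t ≠ 0) (htδ : |t| ≤ δ) :
    u |t| ≤ (Ioc 0 δ).indicator u t + (Ioc 0 δ).indicator u (-t) := by
  have hnn : ∀ r, 0 ≤ (Ioc 0 δ).indicator u r :=
    fun r => indicator_nonneg (fun s hs => hu0 s hs.1) r
  rcases ht.lt_or_gt with h | h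
  · rw [abs_of_neg h] at *
    have : (Ioc 0 δ).indicator u (-t) = u (-t) := indicator_of_mem (mem_Ioc.2 ⟨neg_pos.2 h, htδ⟩) u
    linarith [hnn t]
  · rw [abs_of_pos h] at *
    have : (Ioc 0 δ).indicator u t = u t := indicator_of_mem (mem_Ioc.2 ⟨h, htδ⟩) u
    linarith [hnn (-t)]

theorem aestronglyMeasurable_comp_abs_of_antitoneOn {u : ℝ → ℝ} (hu : AntitoneOn u (Ioi 0)) :
    AEStronglyMeasurable (fun t => u |t|) := by
  have h : AEMeasurable ((Ioi 0).indicator u) :=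
    (aemeasurable_indicator_iff measurableSet_Ioi).2
      (aemeasurable_restrict_of_antitoneOn measurableSet_Ioi hu)
  have hneg : AEMeasurable (fun t => (Ioi 0).indicator u (-t)) :=
    h.comp_quasiMeasurePreserving
      (Measure.measurePreserving_neg (volume : Measure ℝ)).quasiMeasurePreserving
  refine ((h.add hneg).congr ?_).aestronglyMeasurable
  filter_upwards [Measure.ae_ne volume (0 : ℝ)] with t ht
  rcases ht.lt_or_gt with h | h
  · simp [indicator, h, h.le, abs_of_neg h]
  · simp [indicator, h, h.le, abs_of_pos h]

/-- The Poisson density `u(|t|) / (1 + t²)` is integrable when `u` is antitone and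
integrable near the origin. -/
theorem integrable_comp_abs_div_one_add_sq {u : ℝ → ℝ} (hu : AntitoneOn u (Ioi 0))
    (hu0 : ∀ s, 0 < s → 0 ≤ u s) (hint : IntegrableOn u (Ioc 0 1)) :
    Integrable (fun t : ℝ => u |t| / (1 + t ^ 2)) := by
  refine ((integrable_indicator_add_comp_neg hint).add
    (integrable_inv_one_add_sq.const_mul (u 1))).mono' ?_ ?_
  · exact (aestronglyMeasurable_comp_abs_of_antitoneOn hu).mul
      (f := fun t => u |t|) (g := fun t : ℝ => (1 + t ^ 2)⁻¹)
      integrable_inv_one_add_sq.aestronglyMeasurable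
  · filter_upwards [Measure.ae_ne volume (0 : ℝ)] with t ht
    have ht0 : 0 < |t| := abs_pos.2 ht
    have hut := hu0 _ ht0
    have hu1 := hu0 1 one_pos
    have hnn : ∀ r, 0 ≤ (Ioc 0 1).indicator u r :=
      fun r => indicator_nonneg (fun s hs => hu0 s hs.1) r
    rw [Real.norm_of_nonneg (by positivity), Pi.add_apply]
    rcases le_total |t| 1 with h | h
    · have h1 := comp_abs_le_indicator_add hu0 ht h
      have h2 : u |t| / (1 + t ^ 2) ≤ u |t| := div_le_self hut (by nlinarith [sq_nonneg t])
      have h3 : 0 ≤ u 1 * (1 + t ^ 2)⁻¹ := by positivity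
      linarith
    · have h1 : u |t| ≤ u 1 := hu (mem_Ioi.2 one_pos) ht0 h
      have h2 : u |t| * (1 + t ^ 2)⁻¹ ≤ u 1 * (1 + t ^ 2)⁻¹ := by gcongr
      rw [div_eq_mul_inv]
      linarith [hnn t, hnn (-t)]

/-- The unnormalised Poisson kernel of the right half-plane. -/
noncomputable def halfPlanePoisson (x y t : ℝ) : ℝ := x / (x ^ 2 + (t - y) ^ 2)

theorem halfPlanePoisson_eq {x : ℝ} (hx : 0 < x) (y t : ℝ) :
    halfPlanePoisson x y t = x⁻¹ * (1 + (x⁻¹ * (t - y)) ^ 2)⁻¹ := by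
  unfold halfPlanePoisson
  field_simp

theorem halfPlanePoisson_nonneg {x : ℝ} (hx : 0 < x) (y t : ℝ) : 0 ≤ halfPlanePoisson x y t := by
  unfold halfPlanePoisson
  positivity

theorem halfPlanePoisson_le_inv {x : ℝ} (hx : 0 < x) (y t : ℝ) :
    halfPlanePoisson x y t ≤ x⁻¹ := by
  unfold halfPlanePoisson
  rw [div_le_iff₀ (by positivity)]
  have : x⁻¹ * x = 1 := inv_mul_cancel₀ hx.ne'
  have h2 : 0 ≤ x⁻¹ * (t - y) ^ 2 := by positivity
  nlinarith

theorem integrable_halfPlanePoisson {x : ℝ} (hx : 0 < x) (y : ℝ) :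
    Integrable (halfPlanePoisson x y) := by
  rw [funext (halfPlanePoisson_eq hx y)]
  exact ((integrable_inv_one_add_sq.comp_mul_left' (inv_ne_zero hx.ne')).comp_sub_right y).const_mul _

theorem integral_halfPlanePoisson {x : ℝ} (hx : 0 < x) (y : ℝ) :
    ∫ t, halfPlanePoisson x y t = Real.pi := by
  simp_rw [halfPlanePoisson_eq hx y]
  rw [integral_const_mul,
    integral_sub_right_eq_self (fun t => (1 + (x⁻¹ * t) ^ 2)⁻¹) y,
    Measure.integral_comp_mul_left (fun t : ℝ => (1 + t ^ 2)⁻¹), integral_univ_inv_one_add_sq,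
    inv_inv, abs_of_pos hx, smul_eq_mul, inv_mul_cancel_left₀ hx.ne']

theorem setIntegral_halfPlanePoisson {x : ℝ} (hx : 0 < x) (y : ℝ) :
    ∫ t in Ioc (y - x) (y + x), halfPlanePoisson x y t = Real.pi / 2 := by
  rw [← intervalIntegral.integral_of_le (by linarith)]
  simp_rw [halfPlanePoisson_eq hx y]
  rw [intervalIntegral.integral_const_mul,
    intervalIntegral.integral_comp_sub_right (fun t => (1 + (x⁻¹ * t) ^ 2)⁻¹) y,
    intervalIntegral.mul_integral_comp_mul_left (f := fun t : ℝ => (1 + t ^ 2)⁻¹)]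
  have h1 : x⁻¹ * (y - x - y) = -1 := by field_simp; ring
  have h2 : x⁻¹ * (y + x - y) = 1 := by field_simp; ring
  rw [h1, h2, integral_inv_one_add_sq, Real.arctan_neg, Real.arctan_one]
  ring

/-- The Poisson integral of `u(|·|)` dominates half of the value of `u` at twice the modulus. -/
theorem le_integral_mul_halfPlanePoisson {u : ℝ → ℝ} (hu : AntitoneOn u (Ioi 0))
    (hu0 : ∀ s, 0 < s → 0 ≤ u s) {x y r : ℝ} (hx : 0 < x) (hxr : x ≤ r) (hyr : |y| ≤ r)
    (hint : Integrable (fun t => u |t| * halfPlanePoisson x y t)) :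
    Real.pi / 2 * u (2 * r) ≤ ∫ t, u |t| * halfPlanePoisson x y t := by
  rw [← setIntegral_halfPlanePoisson hx y, ← integral_mul_const]
  have hnn : 0 ≤ᵐ[volume] fun t => u |t| * halfPlanePoisson x y t := by
    filter_upwards [Measure.ae_ne volume (0 : ℝ)] with t ht
    exact mul_nonneg (hu0 _ (abs_pos.2 ht)) (halfPlanePoisson_nonneg hx y t)
  refine le_trans ?_ (setIntegral_le_integral (s := Ioc (y - x) (y + x)) hint hnn)
  refine setIntegral_mono_on_ae ((integrable_halfPlanePoisson hx y).mul_const _).integrableOn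
    hint.integrableOn measurableSet_Ioc ?_
  filter_upwards [Measure.ae_ne volume (0 : ℝ)] with t ht hmem
  rw [mul_comm]
  refine mul_le_mul_of_nonneg_right ?_ (halfPlanePoisson_nonneg hx y t)
  refine hu (abs_pos.2 ht) (by simp; linarith) (abs_le.2 ?_)
  constructor <;> linarith [hmem.1, hmem.2, (abs_le.1 hyr).1, (abs_le.1 hyr).2]

/-- The Poisson integral of `u(|·|)` is controlled by a tail value of `u` and its mass near `0`. -/
theorem integral_mul_halfPlanePoisson_le {u : ℝ → ℝ} (hu : AntitoneOn u (Ioi 0))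
    (hu0 : ∀ s, 0 < s → 0 ≤ u s) {x y δ : ℝ} (hx : 0 < x) (hδ : 0 < δ)
    (hloc : IntegrableOn u (Ioc 0 δ))
    (hint : Integrable (fun t => u |t| * halfPlanePoisson x y t)) :
    ∫ t, u |t| * halfPlanePoisson x y t ≤
      Real.pi * u δ + x⁻¹ * (2 * ∫ s in Ioc 0 δ, u s) := by
  have h1 := (integrable_halfPlanePoisson hx y).mul_const (u δ)
  have h2 := (integrable_indicator_add_comp_neg hloc).const_mul x⁻¹
  rw [← integral_halfPlanePoisson hx y, ← integral_mul_const, ← integral_indicator_add_comp_neg hloc,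
    ← integral_const_mul, ← integral_add h1 h2]
  refine integral_mono_ae hint (h1.add h2) ?_
  filter_upwards [Measure.ae_ne volume (0 : ℝ)] with t ht
  have ht0 := abs_pos.2 ht
  have hp := halfPlanePoisson_nonneg hx y t
  have hnn : ∀ r, 0 ≤ (Ioc 0 δ).indicator u r :=
    fun r => indicator_nonneg (fun s hs => hu0 s hs.1) r
  rcases le_total |t| δ with h | h
  · have hE := comp_abs_le_indicator_add hu0 ht h
    have h3 := mul_le_mul hE (halfPlanePoisson_le_inv hx y t) hp (add_nonneg (hnn _) (hnn _))
    have h4 := mul_nonneg hp (hu0 δ hδ)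
    linarith
  · have h3 := mul_le_mul_of_nonneg_right (hu hδ ht0 h) hp
    have h4 := mul_nonneg (inv_nonneg.2 hx.le) (add_nonneg (hnn t) (hnn (-t)))
    linarith

theorem I_mul_sub_ne_zero {w : ℂ} (hw : 0 < w.re) (t : ℝ) : Complex.I * (t : ℂ) - w ≠ 0 := by
  intro h
  have := congrArg Complex.re h
  simp at this
  exact hw.ne' this

theorem re_le_norm_I_mul_sub (w : ℂ) (t : ℝ) : w.re ≤ ‖Complex.I * (t : ℂ) - w‖ := by
  have := (neg_le_abs _).trans (Complex.abs_re_le_norm (Complex.I * (t : ℂ) - w))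
  simpa using this

theorem outerKernel_eq {w : ℂ} (hw : 0 < w.re) (t : ℝ) :
    (Complex.I * (t : ℂ) * w - 1) / (Complex.I * (t : ℂ) - w) =
      w + (w ^ 2 - 1) / (Complex.I * (t : ℂ) - w) := by
  field_simp [I_mul_sub_ne_zero hw t]
  ring

theorem outerKernel_re {w : ℂ} (hw : 0 < w.re) (t : ℝ) :
    ((Complex.I * (t : ℂ) * w - 1) / (Complex.I * (t : ℂ) - w)).re =
      (1 + t ^ 2) * halfPlanePoisson w.re w.im t := by
  have hden : Complex.normSq (Complex.I * (t : ℂ) - w) = w.re ^ 2 + (t - w.im) ^ 2 := by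
    simp [Complex.normSq_apply]
    ring
  have hpos : 0 < w.re ^ 2 + (t - w.im) ^ 2 := by positivity
  rw [Complex.div_re, hden, halfPlanePoisson]
  simp
  field_simp
  ring

theorem norm_outerKernel_le {w : ℂ} (hw : 0 < w.re) (t : ℝ) :
    ‖(Complex.I * (t : ℂ) * w - 1) / (Complex.I * (t : ℂ) - w)‖ ≤
      ‖w‖ + (‖w‖ ^ 2 + 1) / w.re := by
  rw [outerKernel_eq hw]
  refine (norm_add_le _ _).trans ?_
  rw [norm_div]
  gcongr
  · exact (norm_sub_le _ _).trans (by simp)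
  · exact re_le_norm_I_mul_sub w t

theorem continuous_outerKernel {w : ℂ} (hw : 0 < w.re) :
    Continuous fun t : ℝ => (Complex.I * (t : ℂ) * w - 1) / (Complex.I * (t : ℂ) - w) :=
  Continuous.div (by fun_prop) (by fun_prop) (I_mul_sub_ne_zero hw)

theorem integrable_mul_outerKernel {g : ℝ → ℝ} (hg : Integrable g) {w : ℂ} (hw : 0 < w.re) :
    Integrable fun t : ℝ =>
      (g t : ℂ) * ((Complex.I * (t : ℂ) * w - 1) / (Complex.I * (t : ℂ) - w)) :=
  hg.ofReal.mul_bdd (continuous_outerKernel hw).aestronglyMeasurable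
    (Eventually.of_forall (norm_outerKernel_le hw))

theorem hasDerivAt_outerKernel {w : ℂ} (hw : 0 < w.re) (t : ℝ) :
    HasDerivAt (fun z : ℂ => (Complex.I * (t : ℂ) * z - 1) / (Complex.I * (t : ℂ) - z))
      (-(1 + (t : ℂ) ^ 2) / (Complex.I * (t : ℂ) - w) ^ 2) w := by
  have h := (((hasDerivAt_id w).const_mul (Complex.I * (t : ℂ))).sub_const 1).div
    ((hasDerivAt_id w).const_sub (Complex.I * (t : ℂ))) (I_mul_sub_ne_zero hw t)
  refine h.congr_deriv ?_
  congr 1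
  simp only [id]
  linear_combination (t : ℂ) ^ 2 * Complex.I_sq

theorem norm_deriv_outerKernel_le {w : ℂ} (hw : 0 < w.re) (t : ℝ) :
    ‖-(1 + (t : ℂ) ^ 2) / (Complex.I * (t : ℂ) - w) ^ 2‖ ≤
      1 + 2 * ‖w‖ / w.re + (‖w‖ ^ 2 + 1) / w.re ^ 2 := by
  have hne := I_mul_sub_ne_zero hw t
  have heq : -(1 + (t : ℂ) ^ 2) / (Complex.I * (t : ℂ) - w) ^ 2 =
      1 + 2 * w / (Complex.I * (t : ℂ) - w) + (w ^ 2 - 1) / (Complex.I * (t : ℂ) - w) ^ 2 := by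
    have expand : ∀ D : ℂ, D ≠ 0 →
        1 + 2 * w / D + (w ^ 2 - 1) / D ^ 2 = ((D + w) ^ 2 - 1) / D ^ 2 := by
      intro D hD
      field_simp
      ring
    rw [expand _ hne]
    congr 1
    linear_combination -(t : ℂ) ^ 2 * Complex.I_sq
  rw [heq]
  refine (norm_add₃_le).trans ?_
  rw [norm_div, norm_div, norm_pow, norm_mul]
  have hle := re_le_norm_I_mul_sub w t
  gcongr
  · simp
  · simp
  · exact (norm_sub_le _ _).trans (by simp)

theorem differentiableAt_integral_outerKernel {g : ℝ → ℝ} (hg : Integrable g) {w : ℂ}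
    (hw : 0 < w.re) :
    DifferentiableAt ℂ (fun z : ℂ => ∫ t : ℝ,
      (g t : ℂ) * ((Complex.I * (t : ℂ) * z - 1) / (Complex.I * (t : ℂ) - z))) w := by
  have hre : ∀ z ∈ Metric.ball w (w.re / 2), w.re / 2 < z.re := by
    intro z hz
    rw [Metric.mem_ball, dist_comm, Complex.dist_eq] at hz
    have := (Complex.re_le_norm (w - z)).trans_lt hz
    rw [Complex.sub_re] at this
    linarith
  have hnorm : ∀ z ∈ Metric.ball w (w.re / 2), ‖z‖ ≤ ‖w‖ + w.re / 2 := by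
    intro z hz
    rw [Metric.mem_ball, Complex.dist_eq] at hz
    linarith [norm_le_norm_add_norm_sub' z w]
  have hball : Metric.ball w (w.re / 2) ∈ nhds w := Metric.ball_mem_nhds w (by positivity)
  set M := ‖w‖ + w.re / 2
  refine (hasDerivAt_integral_of_dominated_loc_of_deriv_le
    (F' := fun z t => (g t : ℂ) * (-(1 + (t : ℂ) ^ 2) / (Complex.I * (t : ℂ) - z) ^ 2))
    (bound := fun t => ‖g t‖ * (1 + 2 * M / (w.re / 2) + (M ^ 2 + 1) / (w.re / 2) ^ 2))
    hball ?_ (integrable_mul_outerKernel hg hw) ?_ ?_ (hg.norm.mul_const _) ?_).2.differentiableAt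
  · filter_upwards [hball] with z hz
    exact (integrable_mul_outerKernel hg ((half_pos hw).trans (hre z hz))).aestronglyMeasurable
  · refine hg.ofReal.aestronglyMeasurable.mul (Continuous.aestronglyMeasurable ?_)
    exact Continuous.div (by fun_prop) (by fun_prop) fun t => pow_ne_zero 2 (I_mul_sub_ne_zero hw t)
  · refine Eventually.of_forall fun t z hz => ?_
    rw [norm_mul, Complex.norm_real]
    have h1 := hre z hz
    have h2 := hnorm z hz
    refine mul_le_mul_of_nonneg_left
      ((norm_deriv_outerKernel_le ((half_pos hw).trans h1) t).trans ?_) (norm_nonneg _)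
    gcongr
  · exact Eventually.of_forall fun t z hz =>
      (hasDerivAt_outerKernel ((half_pos hw).trans (hre z hz)) t).const_mul _

theorem integrable_mul_halfPlanePoisson {u : ℝ → ℝ}
    (hg : Integrable (fun t : ℝ => u |t| / (1 + t ^ 2))) {w : ℂ} (hw : 0 < w.re) :
    Integrable fun t => u |t| * halfPlanePoisson w.re w.im t := by
  refine (integrable_mul_outerKernel hg hw).re.congr (Eventually.of_forall fun t => ?_)
  have : (1 + t ^ 2 : ℝ) ≠ 0 := by positivity
  simp only [RCLike.re_to_complex, Complex.re_ofReal_mul, outerKernel_re hw]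
  field_simp

/-- The modulus of the outer function is the exponential of a Poisson integral. -/
theorem norm_outer_eq {u : ℝ → ℝ} (hg : Integrable (fun t : ℝ => u |t| / (1 + t ^ 2))) (a : ℝ)
    {w : ℂ} (hw : 0 < w.re) :
    ‖Complex.exp ((1 / (Real.pi : ℂ)) * ∫ t : ℝ, (((-a * u |t|) / (1 + t ^ 2) : ℝ) : ℂ) *
      ((Complex.I * (t : ℂ) * w - 1) / (Complex.I * (t : ℂ) - w)))‖ =
    Real.exp (-(a / Real.pi * ∫ t, u |t| * halfPlanePoisson w.re w.im t)) := by
  have hga : Integrable fun t : ℝ => (-a * u |t|) / (1 + t ^ 2) := by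
    simpa only [mul_div_assoc] using hg.const_mul (-a)
  have hre : (∫ t : ℝ, (((-a * u |t|) / (1 + t ^ 2) : ℝ) : ℂ) *
      ((Complex.I * (t : ℂ) * w - 1) / (Complex.I * (t : ℂ) - w))).re =
      -a * ∫ t, u |t| * halfPlanePoisson w.re w.im t := by
    rw [← integral_const_mul]
    refine (integral_re (integrable_mul_outerKernel hga hw)).symm.trans
      (integral_congr_ae (Eventually.of_forall fun t => ?_))
    have : (1 + t ^ 2 : ℝ) ≠ 0 := by positivity
    simp only [RCLike.re_to_complex, Complex.re_ofReal_mul, outerKernel_re hw]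
    field_simp
  have hcast : (1 / (Real.pi : ℂ)) = ((1 / Real.pi : ℝ) : ℂ) := by push_cast; rfl
  rw [Complex.norm_exp, hcast, Complex.re_ofReal_mul, hre]
  congr 1
  ring

/-- Lemma 2.1.3 analogue: the outer functions `F_a` are holomorphic
on the right half-plane and satisfy the two-sided estimate. -/
theorem outer_function_estimates
    (ω : ℝ → ℝ) (hω : IsWeightFunction ω) (h5 : Omega5 ω)
    (hγι : 1 < gammaIndex (upperConjIota ω))
    (F : ℝ → ℂ → ℂ)
    (hF : ∀ a : ℝ, ∀ w : ℂ, F a w =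
      Complex.exp ((1 / (Real.pi : ℂ)) *
        ∫ t : ℝ, (((-a * upperConj ω |t|) / (1 + t ^ 2) : ℝ) : ℂ) *
          ((Complex.I * (t : ℂ) * w - 1) / (Complex.I * (t : ℂ) - w)))) :
    (∀ a : ℝ, 0 < a → DifferentiableOn ℂ (F a) {ξ : ℂ | 0 < ξ.re}) ∧
    ∃ A B : ℝ, 1 ≤ A ∧ 1 ≤ B ∧
      ∀ a : ℝ, 0 < a → ∀ ξ : ℂ, 0 < ξ.re →
        B ^ (-a) * Real.exp (-(2 * a) * upperConj ω (B⁻¹ * ξ.re)) ≤ ‖F a ξ‖ ∧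
        ‖F a ξ‖ ≤ Real.exp (-(a / 2) * upperConj ω (A * ‖ξ‖)) := by
  obtain ⟨q, c, s₀, hq, hq1, hs₀, hqc, hgrowth⟩ := exists_upperConj_comp_mul_le hω h5 hγι
  have hu := upperConj_antitoneOn hω h5
  have hu0 : ∀ s, 0 < s → 0 ≤ upperConj ω s := fun s hs => upperConj_nonneg hω h5 hs
  have hloc := integrableOn_Ioc_of_comp_mul_le hu hu0 hq hq1 hs₀ hqc hgrowth
  obtain ⟨C, hC, hmass⟩ := exists_setIntegral_Ioc_le_of_comp_mul_le hu hu0 hq hq1 hs₀ hqc hgrowth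
  have hg := integrable_comp_abs_div_one_add_sq hu hu0 (hloc 1)
  refine ⟨fun a _ w hw => ?_, 2, max C (Real.exp 1), one_le_two,
    le_max_of_le_right (Real.one_le_exp zero_le_one), fun a ha w hw => ?_⟩
  · rw [funext (hF a)]
    have hga : Integrable fun t : ℝ => (-a * upperConj ω |t|) / (1 + t ^ 2) := by
      simpa only [mul_div_assoc] using hg.const_mul (-a)
    exact ((differentiableAt_integral_outerKernel hga hw).const_mul _).cexp.differentiableWithinAt
  · set B := max C (Real.exp 1)
    have hB : 0 < B := hC.trans_le (le_max_left _ _)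
    have hlogB : 1 ≤ Real.log B := (Real.le_log_iff_exp_le hB).2 (le_max_right _ _)
    have hint := integrable_mul_halfPlanePoisson hg hw
    have hpi := Real.pi_pos
    have hδ : 0 < B⁻¹ * w.re := mul_pos (inv_pos.2 hB) hw
    rw [hF, norm_outer_eq hg a hw, Real.rpow_def_of_pos hB, ← Real.exp_add]
    set P := ∫ t, upperConj ω |t| * halfPlanePoisson w.re w.im t
    constructor <;> refine Real.exp_le_exp.2 ?_
    · set U := upperConj ω (B⁻¹ * w.re)
      have hU : 0 ≤ U := hu0 _ hδ
      have hP : P ≤ Real.pi * U + w.re⁻¹ * (2 * ∫ s in Ioc 0 (B⁻¹ * w.re), upperConj ω s) :=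
        integral_mul_halfPlanePoisson_le hu hu0 hw hδ (hloc _) hint
      have hm : w.re⁻¹ * (2 * ∫ s in Ioc 0 (B⁻¹ * w.re), upperConj ω s) ≤ 2 * (U + 1) := by
        calc _ ≤ w.re⁻¹ * (2 * (C * (B⁻¹ * w.re) * (U + 1))) := by
              gcongr
              exact hmass _ hδ
          _ = C / B * (2 * (U + 1)) := by field_simp
          _ ≤ 1 * (2 * (U + 1)) := by
              gcongr
              exact (div_le_one hB).2 (le_max_left _ _)
          _ = _ := one_mul _
      have hPU : P ≤ Real.pi * (2 * U + Real.log B) := by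
        nlinarith [Real.pi_gt_three]
      have : a / Real.pi * P ≤ a * (2 * U + Real.log B) := by
        rw [div_mul_eq_mul_div, div_le_iff₀ hpi]
        nlinarith
      linarith
    · have hP : Real.pi / 2 * upperConj ω (2 * ‖w‖) ≤ P :=
        le_integral_mul_halfPlanePoisson hu hu0 hw (Complex.re_le_norm w)
          (Complex.abs_im_le_norm w) hint
      have : a / 2 * upperConj ω (2 * ‖w‖) ≤ a / Real.pi * P := by
        rw [div_mul_eq_mul_div a Real.pi, le_div_iff₀ hpi]
        nlinarith
      linarith
end
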